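/- arXiv:2208.05261 — 4 statements merged into one kernel-verified Lean document; each statement's English description precedes it below -/
import Mathlib

section
/- The numbers of minimal Roman dominating functions of short paths are: C_{P,1} = 1, C_{P,2} = 3, C_{P,3} = 4, C_{P,4} = 7, C_{P,5} = 12, C_{P,6} = 20, and C_{P,7} = 34. -/
/-- A Roman dominating function: every vertex with value 0 has a neighbor with value 2. -/
def IsRDF {V : Type*} (G : SimpleGraph V) (f : V → Fin 3) : Prop :=
  ∀ v, f v = 0 → ∃ u, G.Adj v u ∧ f u = 2

/-- A minimal Roman dominating function: an rdf such that no rdf `g ≠ f` satisfies `g ≤ f`. -/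
def IsMinimalRDF {V : Type*} (G : SimpleGraph V) (f : V → Fin 3) : Prop :=
  IsRDF G f ∧ ∀ g : V → Fin 3, IsRDF G g → g ≤ f → g = f

/-- The number of minimal Roman dominating functions of `G`. -/
noncomputable def numMinRDF {V : Type*} (G : SimpleGraph V) : ℕ :=
  {f : V → Fin 3 | IsMinimalRDF G f}.ncard

/-- `C_{P,n}`: the number of minimal Roman dominating functions of the path `Pₙ`. -/
noncomputable def CP (n : ℕ) : ℕ := numMinRDF (SimpleGraph.pathGraph n)

/-- `C_{P,2,n}`: the number of minimal rdf `f` of `Pₙ` with `f(v₁) = 2`. -/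
noncomputable def CP2 (n : ℕ) : ℕ :=
  {f : Fin n → Fin 3 | IsMinimalRDF (SimpleGraph.pathGraph n) f ∧
    ∃ h : 0 < n, f ⟨0, h⟩ = 2}.ncard

/-- `C_{P,2̄,n}`: the number of minimal rdf `f` of `Pₙ` with `f(v₁) ≠ 2`. -/
noncomputable def CPbar2 (n : ℕ) : ℕ :=
  {f : Fin n → Fin 3 | IsMinimalRDF (SimpleGraph.pathGraph n) f ∧
    ∀ h : 0 < n, f ⟨0, h⟩ ≠ 2}.ncard

section MinimalRDF

variable {V : Type*} {G : SimpleGraph V}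

theorem IsRDF.mono {f g : V → Fin 3} (hf : IsRDF G f) (hfg : f ≤ g) : IsRDF G g := by
  intro v hv
  obtain ⟨u, huv, hu⟩ := hf v (le_antisymm (hv ▸ hfg v) (Fin.zero_le _))
  exact ⟨u, huv, le_antisymm (Fin.le_last _) (hu ▸ hfg u)⟩

/-- Minimality of a Roman dominating function can be tested by lowering one value by one. -/
theorem isMinimalRDF_iff_update [DecidableEq V] {f : V → Fin 3} :
    IsMinimalRDF G f ↔
      IsRDF G f ∧ ∀ v, f v ≠ 0 → ¬ IsRDF G (Function.update f v (f v - 1)) := by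
  refine and_congr_right fun _ => ⟨fun h v hv hr => ?_, fun h g hg hgf => ?_⟩
  · have hle : f v - 1 ≤ f v := by generalize f v = a at hv ⊢; decide +revert
    have := congrFun (h _ hr (update_le_self_iff.2 hle)) v
    rw [Function.update_self] at this
    generalize f v = a at hv this
    revert a
    decide
  · by_contra hne
    obtain ⟨v, hv⟩ := Function.ne_iff.1 hne
    have hlt : g v < f v := lt_of_le_of_ne (hgf v) hv
    refine h v (Fin.ne_zero_of_lt hlt) (hg.mono (le_update_iff.2 ⟨?_, fun u _ => hgf u⟩))
    generalize g v = a, f v = b at hlt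
    decide +revert

/-- The local characterization of minimal Roman dominating functions. -/
theorem isMinimalRDF_iff_local {f : V → Fin 3} :
    IsMinimalRDF G f ↔ ∀ v, (f v = 0 → ∃ u, G.Adj v u ∧ f u = 2) ∧
      (f v = 1 → ∀ u, G.Adj v u → f u ≠ 2) ∧
      (f v = 2 → ∃ u, G.Adj v u ∧ f u = 0 ∧ ∀ w, G.Adj u w → f w = 2 → w = v) := by
  classical
  rw [isMinimalRDF_iff_update, IsRDF, ← forall_and]
  have key (hf : IsRDF G f) (v : V) : (f v ≠ 0 → ¬ IsRDF G (Function.update f v (f v - 1))) ↔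
      (f v = 1 → ∀ u, G.Adj v u → f u ≠ 2) ∧
      (f v = 2 → ∃ u, G.Adj v u ∧ f u = 0 ∧ ∀ w, G.Adj u w → f w = 2 → w = v) := by
    have h3 : f v = 0 ∨ f v = 1 ∨ f v = 2 := by generalize f v = a; decide +revert
    rcases h3 with hv | hv | hv
    · simp [hv]
    · simp only [hv, ne_eq, one_ne_zero, not_false_eq_true, forall_const, sub_self]
      have h12 : (1 : Fin 3) ≠ 2 := by decide
      simp only [h12, false_imp_iff, and_true]
      refine ⟨fun h u huv hu => h fun w hw => ?_, fun h hr => ?_⟩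
      · by_cases hwv : w = v
        · subst hwv
          exact ⟨u, huv, by rwa [Function.update_of_ne huv.ne']⟩
        · rw [Function.update_of_ne hwv] at hw
          obtain ⟨x, hx, hx2⟩ := hf w hw
          refine ⟨x, hx, ?_⟩
          rwa [Function.update_of_ne]
          rintro rfl
          exact h12 (hv.symm.trans hx2)
      · obtain ⟨u, huv, hu⟩ := hr v (by simp)
        rw [Function.update_of_ne huv.ne'] at hu
        exact h u huv hu
    · have h20 : (2 : Fin 3) ≠ 0 := by decide
      have h21 : (2 : Fin 3) ≠ 1 := by decide
      have h12 : (2 : Fin 3) - 1 = 1 := by decide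
      simp only [hv, ne_eq, h20, not_false_eq_true, forall_const, h21, false_imp_iff, true_and,
        h12]
      refine ⟨fun h => ?_, ?_⟩
      · by_contra! hc
        refine h fun w hw => ?_
        have hwv : w ≠ v := by rintro rfl; simp at hw
        rw [Function.update_of_ne hwv] at hw
        obtain ⟨x, hx, hx2⟩ := hf w hw
        by_cases hxv : x = v
        · subst hxv
          obtain ⟨y, hy, hy2, hyx⟩ := hc w hx.symm hw
          exact ⟨y, hy, by rwa [Function.update_of_ne hyx]⟩
        · exact ⟨x, hx, by rwa [Function.update_of_ne hxv]⟩
      · rintro ⟨u, huv, hu, huniq⟩ hr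
        obtain ⟨w, hw, hw2⟩ := hr u (by rwa [Function.update_of_ne huv.ne'])
        by_cases hwv : w = v
        · subst hwv
          simp [h21.symm] at hw2
        · rw [Function.update_of_ne hwv] at hw2
          exact hwv (huniq w hw hw2)
  constructor
  · intro h v
    exact ⟨(h v).1, (key (fun w => (h w).1) v).1 (h v).2⟩
  · intro h v
    exact ⟨(h v).1, (key (fun w => (h w).1) v).2 (h v).2⟩

end MinimalRDF

/-- The condition that minimality imposes on five consecutive values of a function on a path,
where the path is continued by the value 1 on both sides. -/
def windowOK (a b c d e : Fin 3) : Bool :=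
  (c != 0 || (b == 2 || d == 2)) && (c != 1 || (b != 2 && d != 2)) &&
    (c != 2 || ((b == 0 && a != 2) || (d == 0 && e != 2)))

/-- All windows of five consecutive entries satisfy `windowOK`. -/
def allWindowsOK : List (Fin 3) → Bool
  | a :: b :: c :: d :: e :: l => windowOK a b c d e && allWindowsOK (b :: c :: d :: e :: l)
  | _ => true

theorem allWindowsOK_iff (l : List (Fin 3)) : allWindowsOK l ↔ ∀ i, i + 4 < l.length →
    windowOK (l.getD i 1) (l.getD (i + 1) 1) (l.getD (i + 2) 1) (l.getD (i + 3) 1)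
      (l.getD (i + 4) 1) := by
  fun_induction allWindowsOK l with
  | case1 a b c d e l ih =>
    rw [Bool.and_eq_true, ih]
    refine ⟨fun h i hi => ?_, fun h => ⟨h 0 (by simp), fun i hi => ?_⟩⟩
    · cases i with
      | zero => exact h.1
      | succ i => exact h.2 i (by simpa using hi)
    · exact h (i + 1) (by simpa using hi)
  | case2 l hl =>
    refine iff_of_true rfl fun i hi => ?_
    match l, hl, hi with
    | a :: b :: c :: d :: e :: l, hl, _ => exact (hl _ _ _ _ _ _ rfl).elim

theorem allWindowsOK_of_append {l₁ l₂ : List (Fin 3)} (h : allWindowsOK (l₁ ++ l₂)) :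
    allWindowsOK l₂ := by
  induction l₁ with
  | nil => exact h
  | cons a l₁ ih =>
    refine ih ((allWindowsOK_iff _).2 fun i hi => ?_)
    exact (allWindowsOK_iff _).1 h (i + 1) (by simp at hi ⊢; lia)

theorem isMinimalRDF_pathGraph_iff {n : ℕ} (f : Fin n → Fin 3) :
    IsMinimalRDF (SimpleGraph.pathGraph n) f ↔
      allWindowsOK ([1, 1] ++ (List.ofFn f ++ [1, 1])) := by
  rw [allWindowsOK_iff, isMinimalRDF_iff_local]
  generalize hF : (fun i => ([1, 1] ++ (List.ofFn f ++ [1, 1])).getD i 1) = F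
  have hF1 (v : Fin n) : F (v + 2) = f v := by
    subst hF
    simp [List.getElem?_append_left]
  have hF2 (i : ℕ) (hi : F i ≠ 1) : ∃ v : Fin n, i = v + 2 := by
    subst hF
    by_contra! hc
    refine hi ?_
    match i with
    | 0 => rfl
    | 1 => rfl
    | i + 2 =>
      have hin : n ≤ i := by
        by_contra! hlt
        exact hc ⟨i, hlt⟩ rfl
      have (k : ℕ) : ([1, 1] : List (Fin 3))[k]?.getD 1 = 1 := by
        match k with
        | 0 | 1 | k + 2 => simp
      simp [List.getElem?_append_right, hin, this]
  have hadj (v u : Fin n) : (SimpleGraph.pathGraph n).Adj v u ↔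
      (u + 2 : ℕ) = v + 1 ∨ (u + 2 : ℕ) = v + 3 := by
    rw [SimpleGraph.pathGraph_adj]
    lia
  have hex (v : Fin n) (p : ℕ → Prop) (hp : ∀ i, p i → F i ≠ 1) :
      (∃ u : Fin n, (SimpleGraph.pathGraph n).Adj v u ∧ p (u + 2)) ↔ p (v + 1) ∨ p (v + 3) := by
    simp only [hadj]
    constructor
    · rintro ⟨u, hu | hu, h⟩
      · exact .inl (hu ▸ h)
      · exact .inr (hu ▸ h)
    · rintro (h | h) <;> obtain ⟨u, hu⟩ := hF2 _ (hp _ h)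
      · exact ⟨u, .inl hu.symm, hu ▸ h⟩
      · exact ⟨u, .inr hu.symm, hu ▸ h⟩
  have h01 : (0 : Fin 3) ≠ 1 := by decide
  have h21 : (2 : Fin 3) ≠ 1 := by decide
  have htwo (v : Fin n) : (∃ u, (SimpleGraph.pathGraph n).Adj v u ∧ f u = 2) ↔
      F (v + 1) = 2 ∨ F (v + 3) = 2 := by
    simp only [← hex v (F · = 2) fun i hi => hi ▸ h21, hF1]
  have hpriv (v : Fin n) : (∃ u, (SimpleGraph.pathGraph n).Adj v u ∧ f u = 0 ∧
        ∀ w, (SimpleGraph.pathGraph n).Adj u w → f w = 2 → w = v) ↔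
      (F (v + 1) = 0 ∧ F v ≠ 2) ∨ (F (v + 3) = 0 ∧ F (v + 4) ≠ 2) := by
    have huniq (i : ℕ) (hi : i ≠ v + 2) : (∀ w : Fin n, (w + 2 : ℕ) = i → f w = 2 → w = v) ↔
        F i ≠ 2 := by
      refine ⟨fun h h2 => ?_, fun h w hw hw2 => (h (hw ▸ hF1 w ▸ hw2)).elim⟩
      obtain ⟨w, rfl⟩ := hF2 i (h2 ▸ h21)
      exact hi (by rw [h w rfl (hF1 w ▸ h2)])
    rw [← huniq v (by lia), ← huniq (v + 4) (by lia)]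
    convert hex v (fun i => F i = 0 ∧ ∀ w : Fin n, (w + 3 = i ∨ w + 1 = i) → f w = 2 → w = v)
      (fun i hi => hi.1 ▸ h01) using 3 with u
    · simp only [hF1, hadj]
      grind
    · grind
    · grind
  have hlen : ([1, 1] ++ (List.ofFn f ++ [1, 1])).length = n + 4 := by simp
  simp only [hlen, Nat.add_lt_add_iff_right, congrFun hF]
  refine Iff.trans (forall_congr' fun v => ?_) (Fin.forall_iff (p := fun v : Fin n =>
    windowOK (F v) (F (v + 1)) (F (v + 2)) (F (v + 3)) (F (v + 4)) = true))
  have hone : (∀ u, (SimpleGraph.pathGraph n).Adj v u → f u ≠ 2) ↔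
      ¬ (F (v + 1) = 2 ∨ F (v + 3) = 2) := by
    simp [← htwo]
  rw [hpriv, hone, htwo, ← hF1]
  simp [windowOK, or_iff_not_imp_left, and_assoc]

/-- The number of functions `f` on `Fin n` for which `[1, 1] ++ (List.ofFn f ++ l)` passes
`allWindowsOK`, computed by extending `l` to the left and discarding failing suffixes. -/
def countExtensions : ℕ → List (Fin 3) → ℕ
  | 0, l => if allWindowsOK ([1, 1] ++ l) then 1 else 0
  | n + 1, l => if allWindowsOK l then
      countExtensions n (0 :: l) + countExtensions n (1 :: l) + countExtensions n (2 :: l) else 0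

theorem card_allWindowsOK (n : ℕ) (l : List (Fin 3)) :
    (Finset.univ.filter fun f : Fin n → Fin 3 =>
      allWindowsOK ([1, 1] ++ (List.ofFn f ++ l))).card = countExtensions n l := by
  induction n generalizing l with
  | zero =>
    rw [countExtensions]
    split_ifs with h <;> simp_all
  | succ n ih =>
    rw [countExtensions]
    split_ifs with h
    · rw [← ih, ← ih, ← ih]
      simp only [Finset.card_filter]
      rw [← (Fin.snocEquiv fun _ => Fin 3).sum_comp, Fintype.sum_prod_type, Fin.sum_univ_three]
      simp [Fin.snocEquiv, -List.ofFn_succ, List.ofFn_succ', List.concat_eq_append]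
    · rw [Finset.card_eq_zero, Finset.filter_eq_empty_iff]
      intro f _ hf
      exact h (allWindowsOK_of_append (allWindowsOK_of_append hf))

theorem CP_eq_countExtensions (n : ℕ) : CP n = countExtensions n [1, 1] := by
  rw [CP, numMinRDF, ← card_allWindowsOK, ← Set.ncard_coe_finset]
  simp only [isMinimalRDF_pathGraph_iff, Finset.coe_filter, Finset.mem_univ, true_and]

/-- The numbers of minimal Roman dominating functions of short paths. -/
theorem CP_small_values :
    CP 1 = 1 ∧ CP 2 = 3 ∧ CP 3 = 4 ∧ CP 4 = 7 ∧ CP 5 = 12 ∧ CP 6 = 20 ∧ CP 7 = 34 := by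
  simp only [CP_eq_countExtensions]
  decide
end

section
/- Every forest (finite simple acyclic graph) of order n has at most (√3)^n minimal Roman dominating functions. -/
namespace RomanForest

open Finset

/-- The state of a vertex `v` of a forest from which some pendant subtrees have been removed,
relative to a set `D` of vertices (the vertices of value `2`): whether `v ∈ D`, and how the part
of `D` in the subtrees removed at `v` constrains the rest. -/
inductive VertexState
  /-- in `D`, with a private neighbor in a removed subtree -/
  | satisfied
  /-- in `D`, still needing a private neighbor -/
  | needy
  /-- not in `D`, without neighbors in `D` in the removed subtrees -/
  | free
  /-- not in `D`, and the private neighbor of a removed vertex -/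
  | closed
  /-- not in `D`, with neighbors in `D` in the removed subtrees, all of them satisfied -/
  | used
  deriving DecidableEq

open VertexState

namespace VertexState

instance : Fintype VertexState :=
  ⟨{satisfied, needy, free, closed, used}, fun x ↦ by cases x <;> simp⟩

/-- The vertex belongs to `D`. -/
def Inside : VertexState → Prop
  | satisfied | needy => True
  | _ => False

/-- The state of a vertex after absorbing a pendant neighbor in the given state, if compatible. -/
def merge : VertexState → VertexState → Option VertexState
  | satisfied, satisfied | satisfied, free | satisfied, used => some satisfied
  | needy, satisfied | needy, used => some needy
  | needy, free => some satisfied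
  | free, free | free, closed | free, used => some free
  | free, needy => some closed
  | free, satisfied => some used
  | closed, free | closed, closed | closed, used => some closed
  | used, satisfied | used, free | used, closed | used, used => some used
  | _, _ => none

theorem sum_univ {M : Type*} [AddCommMonoid M] (p : VertexState → M) :
    ∑ x, p x = p satisfied + (p needy + (p free + (p closed + p used))) := by
  have h : (univ : Finset VertexState) = {satisfied, needy, free, closed, used} := rfl
  rw [h]
  simp

end VertexState

/-- The conditions that an assignment of states has to satisfy along the edges of `G`. -/
def Valid {V : Type*} (G : SimpleGraph V) (σ : V → VertexState) : Prop :=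
  (∀ v, σ v = needy → ∃ w, G.Adj v w ∧ σ w = free ∧ ∀ x, G.Adj w x → (σ x).Inside → x = v) ∧
    ∀ v, σ v = closed → ∀ w, G.Adj v w → ¬ (σ w).Inside

open Classical in
/-- The weighted number of valid state assignments. -/
noncomputable def partitionSum {V : Type*} [Fintype V] (G : SimpleGraph V)
    (p : V → VertexState → ℝ) : ℝ :=
  ∑ σ : V → VertexState, if Valid G σ then ∏ v, p v (σ v) else 0

/-- The weights of a vertex after absorbing a pendant neighbor. -/
noncomputable def mergeWeights (p l : VertexState → ℝ) (y : VertexState) : ℝ :=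
  ∑ x, ∑ s, if merge x s = some y then p x * l s else 0

section Merge

variable (p l : VertexState → ℝ)

theorem mergeWeights_satisfied : mergeWeights p l satisfied =
    p satisfied * (l satisfied + l free + l used) + p needy * l free := by
  simp [mergeWeights, sum_univ, merge]; ring

theorem mergeWeights_needy : mergeWeights p l needy =
    p needy * (l satisfied + l used) := by
  simp [mergeWeights, sum_univ, merge]; ring

theorem mergeWeights_free : mergeWeights p l free =
    p free * (l free + l closed + l used) := by
  simp [mergeWeights, sum_univ, merge]; ring

theorem mergeWeights_closed : mergeWeights p l closed =
    p closed * (l free + l closed + l used) + p free * l needy := by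
  simp [mergeWeights, sum_univ, merge]; ring

theorem mergeWeights_used : mergeWeights p l used =
    p free * l satisfied + p used * (l satisfied + l free + l closed + l used) := by
  simp [mergeWeights, sum_univ, merge]; ring

variable {p l}

theorem mergeWeights_nonneg (hp : ∀ x, 0 ≤ p x) (hl : ∀ x, 0 ≤ l x) (y : VertexState) :
    0 ≤ mergeWeights p l y :=
  sum_nonneg fun x _ ↦ sum_nonneg fun s _ ↦ by
    split_ifs
    exacts [mul_nonneg (hp x) (hl s), le_rfl]

end Merge

/-- Cumulative upper bounds for the weights of a vertex. -/
structure Bounded (p : VertexState → ℝ) (α β γ ε δ : ℝ) : Prop where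
  satisfied_le : p satisfied ≤ α
  inside_le : p satisfied + p needy ≤ β
  free_le : p free ≤ γ
  open_le : p free + p used ≤ ε
  outside_le : p free + p used + p closed ≤ δ

theorem Bounded.mergeWeights {p l : VertexState → ℝ} {α β γ ε δ α' β' γ' ε' δ' : ℝ}
    (hp : Bounded p α β γ ε δ) (hl : Bounded l α' β' γ' ε' δ')
    (p0 : ∀ x, 0 ≤ p x) (l0 : ∀ x, 0 ≤ l x) (h1 : γ' ≤ ε') (h2 : α' ≤ β') :
    Bounded (mergeWeights p l) (α * (α' + ε' - γ') + β * γ') (β * (α' + ε')) (γ * δ')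
      (ε * (α' + δ')) (δ * δ' + ε * α' + γ * (β' - α')) := by
  obtain ⟨p1, p2, p3, p4, p5⟩ := hp
  obtain ⟨l1, l2, l3, l4, l5⟩ := hl
  have pa := p0 satisfied
  have pb := p0 needy
  have pc := p0 free
  have pd := p0 closed
  have pe := p0 used
  have la := l0 satisfied
  have lb := l0 needy
  have lc := l0 free
  have ld := l0 closed
  have le := l0 used
  constructor <;> simp only [mergeWeights_satisfied, mergeWeights_needy, mergeWeights_free,
    mergeWeights_closed, mergeWeights_used]
  · have e1 := mul_le_mul_of_nonneg_left (add_le_add l1 l4) pa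
    have e2 := mul_le_mul_of_nonneg_left l3 pb
    have e3 := mul_le_mul_of_nonneg_right p1 (by linarith : 0 ≤ α' + ε' - γ')
    have e4 := mul_le_mul_of_nonneg_right p2 (by linarith : 0 ≤ γ')
    nlinarith
  · have e1 := mul_le_mul p2 (add_le_add l1 l4) (by positivity) (by linarith)
    nlinarith
  · have e1 := mul_le_mul p3 l5 (by positivity) (by linarith)
    nlinarith
  · have e1 := mul_le_mul p4 (add_le_add l1 l5) (by positivity) (by linarith)
    nlinarith
  · have e1 := mul_le_mul p5 l5 (by positivity) (by linarith)
    have e2 := mul_le_mul_of_nonneg_left l1 pe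
    have e3 := mul_le_mul_of_nonneg_left l2 pc
    have e4 := mul_le_mul_of_nonneg_right p4 (by linarith : 0 ≤ α')
    have e5 := mul_le_mul_of_nonneg_right p3 (by linarith : 0 ≤ β' - α')
    nlinarith

/-- The region of admissible weights; it contains the weights of a single vertex when `q = 1 / √3`
and is closed under merging. -/
def Admissible (q : ℝ) (p : VertexState → ℝ) : Prop :=
  Bounded p 0 q q q q ∨
  Bounded p (1 / 3) (1 / 3) (1 / 3) (1 / 3) (2 / 3) ∨
  Bounded p (q / 3) (2 * q / 3) (2 * q / 3) q q ∨
  Bounded p (2 / 9) (4 / 9) (1 / 3) (4 / 9) (5 / 9) ∨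
  Bounded p (4 * q / 9) (16 * q / 27) (q / 3) (16 * q / 27) (22 * q / 27)

theorem Bounded.mono {p : VertexState → ℝ} {α β γ ε δ α' β' γ' ε' δ' : ℝ}
    (hp : Bounded p α β γ ε δ) (h1 : α ≤ α') (h2 : β ≤ β') (h3 : γ ≤ γ') (h4 : ε ≤ ε')
    (h5 : δ ≤ δ') : Bounded p α' β' γ' ε' δ' :=
  ⟨hp.1.trans h1, hp.2.trans h2, hp.3.trans h3, hp.4.trans h4, hp.5.trans h5⟩

theorem Admissible.mergeWeights {q : ℝ} (hq : q ^ 2 = 1 / 3) (q0 : 0 ≤ q) (q1 : q ≤ 3 / 5)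
    {p l : VertexState → ℝ} (hp : Admissible q p) (hl : Admissible q l)
    (p0 : ∀ x, 0 ≤ p x) (l0 : ∀ x, 0 ≤ l x) : Admissible q (mergeWeights p l) := by
  rcases hp with hp | hp | hp | hp | hp <;> rcases hl with hl | hl | hl | hl | hl <;>
    have h := hp.mergeWeights hl p0 l0 (by linarith) (by linarith)
  all_goals first
    | exact .inr <| .inl <| h.mono (by linarith) (by linarith) (by linarith) (by linarith)
        (by linarith)
    | exact .inr <| .inr <| .inl <| h.mono (by linarith) (by linarith) (by linarith)
        (by linarith) (by linarith)
    | exact .inr <| .inr <| .inr <| .inl <| h.mono (by linarith) (by linarith) (by linarith)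
        (by linarith) (by linarith)
    | exact .inr <| .inr <| .inr <| .inr <| h.mono (by linarith) (by linarith) (by linarith)
        (by linarith) (by linarith)

/-- The total weight of an isolated vertex. -/
def total (p : VertexState → ℝ) : ℝ :=
  p satisfied + p free + p closed + p used

theorem Admissible.total_le_one {q : ℝ} (q1 : q ≤ 3 / 5) {p : VertexState → ℝ}
    (hp : Admissible q p) : total p ≤ 1 := by
  unfold total
  rcases hp with hp | hp | hp | hp | hp <;> linarith [hp.satisfied_le, hp.outside_le]

/-- Every forest with an edge has a leaf. -/
theorem exists_leaf {V : Type*} [Finite V] {G : SimpleGraph V} (hG : G.IsAcyclic) (hne : G ≠ ⊥) :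
    ∃ u l, G.Adj l u ∧ ∀ w, G.Adj l w → w = u := by
  classical
  obtain ⟨a, b, hab⟩ := SimpleGraph.ne_bot_iff_exists_adj.1 hne
  have : Nonempty V := ⟨a⟩
  obtain ⟨u, v, p, hp, hmax⟩ := SimpleGraph.Walk.exists_isPath_forall_isPath_length_le_length G
  have hnil : ¬ p.Nil := by
    have := hmax _ _ (SimpleGraph.Path.singleton hab).1 (SimpleGraph.Path.singleton hab).2
    intro h
    have h0 := SimpleGraph.Walk.length_eq_zero_iff.2 h
    simp [SimpleGraph.Path.singleton] at this
    omega
  refine ⟨_, u, p.adj_snd hnil, fun w hadj ↦ ?_⟩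
  apply hG.eq_snd_of_adj_start hp hadj
  have : ¬ (p.cons hadj.symm).IsPath := by grind [SimpleGraph.Walk.length_cons]
  grind [hp.cons]

/-- Averaging a sum over all functions over the values at one point. -/
theorem sum_sum_update {V S M : Type*} [Fintype V] [DecidableEq V] [Fintype S] [AddCommMonoid M]
    (F : (V → S) → M) (u : V) :
    ∑ σ : V → S, ∑ x, F (Function.update σ u x) = Fintype.card S • ∑ σ, F σ := by
  have hinv : Function.Involutive
      fun z : (V → S) × S ↦ (Function.update z.1 u z.2, z.1 u) := fun z ↦ by simp
  have h := Equiv.sum_comp hinv.toPerm fun z ↦ F z.1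
  simp only [Function.Involutive.coe_toPerm, Fintype.sum_prod_type] at h
  simpa [Finset.smul_sum] using h

/-- Absorbing a leaf keeps an assignment valid. -/
theorem Valid.absorb_leaf {V : Type*} [DecidableEq V] {G : SimpleGraph V} {σ : V → VertexState}
    (h : Valid G σ) {u l : V} (hul : G.Adj l u) (hl : ∀ w, G.Adj l w → w = u) :
    ∃ y, merge (σ u) (σ l) = some y ∧
      Valid (G.deleteEdges {s(l, u)}) (Function.update (Function.update σ u y) l free) := by
  classical
  obtain ⟨h1, h2⟩ := h
  have hne : u ≠ l := hul.ne'
  have hadj : ∀ v w, (G.deleteEdges {s(l, u)}).Adj v w ↔ G.Adj v w ∧ v ≠ l ∧ w ≠ l := by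
    intro v w
    simp only [SimpleGraph.deleteEdges_adj, Set.mem_singleton_iff, Sym2.eq_iff]
    have := hl v
    have := hl w
    have := G.adj_comm v w
    grind
  have key : ∃ y, merge (σ u) (σ l) = some y ∧ (y.Inside ↔ (σ u).Inside) ∧
      (y = needy → σ u = needy ∧ σ l ≠ free) ∧
      (σ u = free → ¬ (σ l).Inside → y = free) ∧
      (y = closed → ∀ w, G.Adj u w → w ≠ l → ¬ (σ w).Inside) := by
    have a1 := h1 l
    have a2 := h2 l
    have a3 := h2 u
    cases hu : σ u <;> cases hs : σ l <;> simp [merge, Inside] <;> grind [Inside, G.adj_comm]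
  obtain ⟨y, hy, hin, hneedy, hfree, hclosed⟩ := key
  set τ := Function.update (Function.update σ u y) l free with hτ
  have τl : τ l = free := by simp [hτ]
  have τu : τ u = y := by simp [hτ, hne]
  have τv : ∀ v, v ≠ l → v ≠ u → τ v = σ v := fun v h h' ↦ by simp [hτ, h, h']
  have τin : ∀ v, v ≠ l → ((τ v).Inside ↔ (σ v).Inside) := by
    intro v h
    by_cases h' : v = u
    · rw [h', τu, hin]
    · rw [τv v h h']
  refine ⟨y, hy, show Valid _ τ from ⟨?_, ?_⟩⟩
  · intro v hv
    have hvl : v ≠ l := by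
      rintro rfl
      simp [τl] at hv
    suffices ∃ w, G.Adj v w ∧ w ≠ l ∧ τ w = free ∧ ∀ x, G.Adj w x → (σ x).Inside → x = v by
      obtain ⟨w, hvw, hwl, hw, hx⟩ := this
      exact ⟨w, (hadj v w).2 ⟨hvw, hvl, hwl⟩, hw, fun x hwx hi ↦
        hx x ((hadj w x).1 hwx).1 ((τin x ((hadj w x).1 hwx).2.2).1 hi)⟩
    by_cases hvu : v = u
    · subst hvu
      obtain ⟨hv1, hl1⟩ := hneedy (τu ▸ hv)
      obtain ⟨w, hw, hwf, hx⟩ := h1 v hv1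
      have hwl : w ≠ l := fun h ↦ hl1 (h ▸ hwf)
      exact ⟨w, hw, hwl, by rw [τv w hwl hw.ne', hwf], hx⟩
    · rw [τv v hvl hvu] at hv
      obtain ⟨w, hw, hwf, hx⟩ := h1 v hv
      have hwl : w ≠ l := fun h ↦ hvu (hl v (h ▸ hw.symm))
      refine ⟨w, hw, hwl, ?_, hx⟩
      by_cases hwu : w = u
      · subst hwu
        rw [τu]
        exact hfree hwf fun hi ↦ hvl (hx l hul.symm hi).symm
      · rw [τv w hwl hwu, hwf]
  · intro v hv w hvw'
    obtain ⟨hvw, hvl, hwl⟩ := (hadj v w).1 hvw'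
    rw [τin w hwl]
    by_cases hvu : v = u
    · subst hvu
      exact hclosed (τu ▸ hv) w hvw hwl
    · exact h2 v (τv v hvl hvu ▸ hv) w hvw

open Classical in
theorem partitionSum_le_absorb_leaf {V : Type*} [Fintype V] {G : SimpleGraph V}
    {p : V → VertexState → ℝ} (p0 : ∀ v x, 0 ≤ p v x)
    {u l : V} (hul : G.Adj l u) (hl : ∀ w, G.Adj l w → w = u) :
    partitionSum G p ≤ partitionSum (G.deleteEdges {s(l, u)})
      (Function.update (Function.update p u (mergeWeights (p u) (p l))) l
        fun s ↦ if s = free then 1 else 0) := by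
  have hne : u ≠ l := hul.ne'
  set G' := G.deleteEdges {s(l, u)}
  set p' := Function.update (Function.update p u (mergeWeights (p u) (p l))) l
        fun s ↦ if s = free then (1 : ℝ) else 0 with hp'
  let τ (σ : V → VertexState) (x s : VertexState) : V → VertexState :=
    Function.update (Function.update σ u x) l s
  have hsum (F : (V → VertexState) → ℝ) :
      ∑ σ, ∑ x, ∑ s, F (τ σ x s) = 25 * ∑ σ, F σ := by
    have hc : Fintype.card VertexState = 5 := rfl
    rw [sum_sum_update (fun σ ↦ ∑ s, F (Function.update σ l s)) u, sum_sum_update, hc]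
    simp only [nsmul_eq_mul]
    push_cast
    ring
  have hprod (r : V → VertexState → ℝ) (σ : V → VertexState) (x s : VertexState) :
      ∏ v, r v (τ σ x s v) = r u x * (r l s * ∏ v ∈ (univ.erase u).erase l, r v (σ v)) := by
    rw [← mul_prod_erase univ _ (mem_univ u),
      ← mul_prod_erase (univ.erase u) _ (mem_erase.2 ⟨hne.symm, mem_univ l⟩)]
    congr 1
    · simp [τ, hne]
    · congr 1
      · simp [τ]
      · refine prod_congr rfl fun v hv ↦ ?_
        simp only [mem_erase] at hv
        simp [τ, hv.1, hv.2.1]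
  refine le_of_mul_le_mul_left ?_ (by norm_num : (0 : ℝ) < 25)
  unfold partitionSum
  rw [← hsum, ← hsum]
  refine sum_le_sum fun σ _ ↦ ?_
  simp only [hprod]
  have hR : ∏ v ∈ (univ.erase u).erase l, p' v (σ v) =
      ∏ v ∈ (univ.erase u).erase l, p v (σ v) := by
    refine prod_congr rfl fun v hv ↦ ?_
    simp only [mem_erase] at hv
    simp [hp', hv.1, hv.2.1]
  have hpu : p' u = mergeWeights (p u) (p l) := by simp [hp', hne]
  have hpl : p' l = fun s ↦ if s = free then 1 else 0 := by simp [hp']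
  rw [hR, hpu, hpl]
  set R := ∏ v ∈ (univ.erase u).erase l, p v (σ v)
  have R0 : 0 ≤ R := prod_nonneg fun v _ ↦ p0 v _
  have hrhs (y : VertexState) :
      (∑ s, if Valid G' (τ σ y s) then
        mergeWeights (p u) (p l) y * ((if s = free then 1 else 0) * R) else 0) =
      ∑ x, ∑ s, if merge x s = some y ∧ Valid G' (τ σ y free) then p u x * (p l s * R) else 0 := by
    rw [sum_eq_single free (by intro s _ hs; simp [hs]) (by simp)]
    by_cases hv : Valid G' (τ σ y free)
    · simp only [hv, if_true, and_true, mergeWeights, sum_mul, ite_mul, zero_mul, one_mul,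
        mul_assoc]
    · simp only [hv, if_false, and_false, sum_const_zero]
  simp only [hrhs]
  refine le_of_le_of_eq (sum_le_sum fun x _ ↦ le_of_le_of_eq (sum_le_sum fun s _ ↦ ?_) sum_comm)
    sum_comm
  have hterm : 0 ≤ p u x * (p l s * R) := mul_nonneg (p0 u x) (mul_nonneg (p0 l s) R0)
  have hnn : ∀ y ∈ univ, 0 ≤ if merge x s = some y ∧ Valid G' (τ σ y free) then
      p u x * (p l s * R) else 0 := fun y _ ↦ by split_ifs <;> simp [hterm]
  split_ifs with hv
  · obtain ⟨y, hy, hv'⟩ := hv.absorb_leaf hul hl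
    have hy' : merge x s = some y := by simpa [τ, hne] using hy
    have hτ : Function.update (Function.update (τ σ x s) u y) l free = τ σ y free := by
      ext v
      by_cases h1 : v = l <;> by_cases h2 : v = u <;> simp [τ, h1, h2, Function.update]
    rw [hτ] at hv'
    refine le_trans ?_ (single_le_sum hnn (mem_univ y))
    simp [hy', hv', G']
  · exact sum_nonneg hnn

theorem partitionSum_bot_le {V : Type*} [Fintype V] {p : V → VertexState → ℝ}
    (p0 : ∀ v x, 0 ≤ p v x) (pt : ∀ v, total (p v) ≤ 1) : partitionSum ⊥ p ≤ 1 := by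
  classical
  calc partitionSum ⊥ p ≤ ∑ σ : V → VertexState, ∏ v, if σ v = needy then 0 else p v (σ v) := by
        refine sum_le_sum fun σ _ ↦ ?_
        split_ifs with h
        · refine (prod_congr rfl fun v _ ↦ ?_).le
          have := h.1 v
          simp_all
        · exact prod_nonneg fun v _ ↦ by split_ifs <;> simp [p0]
    _ = ∏ v, ∑ x, if x = needy then 0 else p v x := by
        rw [prod_univ_sum]
        simp
    _ ≤ 1 := prod_le_one (fun v _ ↦ sum_nonneg fun x _ ↦ by split_ifs <;> simp [p0])
        fun v _ ↦ by
          have := pt v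
          simp only [total] at this
          simp [sum_univ]
          linarith

theorem partitionSum_le_one {V : Type*} [Fintype V] {q : ℝ} (hq : q ^ 2 = 1 / 3) (q0 : 0 ≤ q)
    (q1 : q ≤ 3 / 5) {G : SimpleGraph V} (hG : G.IsAcyclic) {p : V → VertexState → ℝ}
    (p0 : ∀ v x, 0 ≤ p v x) (pt : ∀ v, total (p v) ≤ 1)
    (pa : ∀ v w, G.Adj v w → Admissible q (p v)) : partitionSum G p ≤ 1 := by
  classical
  induction hn : G.edgeSet.ncard using Nat.strong_induction_on generalizing G p with
  | _ n ih =>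
  by_cases hbot : G = ⊥
  · subst hbot
    exact partitionSum_bot_le p0 pt
  obtain ⟨u, l, hul, hl⟩ := exists_leaf hG hbot
  have hne : u ≠ l := hul.ne'
  have hm := (pa u l hul.symm).mergeWeights hq q0 q1 (pa l u hul) (p0 u) (p0 l)
  refine (partitionSum_le_absorb_leaf p0 hul hl).trans ?_
  refine ih _ ?_ (hG.anti (G.deleteEdges_le _)) ?_ ?_ ?_ rfl
  · rw [← hn, SimpleGraph.edgeSet_deleteEdges]
    exact Set.ncard_lt_ncard (Set.sdiff_singleton_ssubset.2 hul) (Set.toFinite _)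
  · intro v x
    by_cases h1 : v = l
    · subst h1
      simp only [Function.update_self]
      split_ifs <;> norm_num
    · by_cases h2 : v = u
      · subst h2
        simpa [h1] using mergeWeights_nonneg (p0 v) (p0 l) x
      · simpa [h1, h2] using p0 v x
  · intro v
    by_cases h1 : v = l
    · subst h1
      simp [total]
    · by_cases h2 : v = u
      · subst h2
        simpa [h1] using hm.total_le_one q1
      · simpa [h1, h2] using pt v
  · intro v w hvw
    have hv := SimpleGraph.deleteEdges_adj.1 hvw
    have h1 : v ≠ l := by
      rintro rfl
      exact hv.2 (by simp [hl w hv.1])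
    by_cases h2 : v = u
    · subst h2
      simpa [h1] using hm
    · simpa [h1, h2] using pa v w hv.1

open Classical in
/-- The state assignment recording the vertices of value `2`. -/
noncomputable def assignment {V : Type*} (f : V → Fin 3) (v : V) : VertexState :=
  if f v = 2 then needy else free

theorem inside_assignment {V : Type*} {f : V → Fin 3} {v : V} :
    (assignment f v).Inside ↔ f v = 2 := by
  unfold assignment
  split_ifs with h <;> simp [h, Inside]

theorem valid_assignment {V : Type*} {G : SimpleGraph V} {f : V → Fin 3}
    (hf : IsMinimalRDF G f) : Valid G (assignment f) := by
  classical
  refine ⟨fun v hv ↦ ?_, fun v hv ↦ ?_⟩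
  · have hv2 : f v = 2 := inside_assignment.1 (by rw [hv]; trivial)
    have hg : ¬ IsRDF G (Function.update f v 1) := by
      intro h
      have hle : Function.update f v 1 ≤ f := by
        intro w
        by_cases hw : w = v
        · subst hw
          simp [hv2]
        · simp [hw]
      have := congrFun (hf.2 _ h hle) v
      simp [hv2] at this
    simp only [IsRDF, not_forall, not_exists, not_and] at hg
    obtain ⟨w, hw, hnone⟩ := hg
    have hwv : w ≠ v := by
      rintro rfl
      simp at hw
    rw [Function.update_of_ne hwv] at hw
    have huniq : ∀ x, G.Adj w x → f x = 2 → x = v := by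
      intro x hx hx2
      by_contra hxv
      exact hnone x hx (by rwa [Function.update_of_ne hxv])
    obtain ⟨x, hx, hx2⟩ := hf.1 w hw
    obtain rfl := huniq x hx hx2
    exact ⟨w, hx.symm, by simp [assignment, hw], fun y hy h ↦ huniq y hy (inside_assignment.1 h)⟩
  · unfold assignment at hv
    split_ifs at hv

theorem eq_zero_iff_of_isMinimalRDF {V : Type*} {G : SimpleGraph V} {f : V → Fin 3}
    (hf : IsMinimalRDF G f) {v : V} (hv : f v ≠ 2) : f v = 0 ↔ ∃ u, G.Adj v u ∧ f u = 2 := by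
  classical
  refine ⟨hf.1 v, fun ⟨u, hu, hu2⟩ ↦ ?_⟩
  have huv : u ≠ v := hu.ne'
  have hrdf : IsRDF G (Function.update f v 0) := by
    intro w hw
    by_cases hwv : w = v
    · subst hwv
      exact ⟨u, hu, by rwa [Function.update_of_ne huv]⟩
    · rw [Function.update_of_ne hwv] at hw
      obtain ⟨x, hx, hx2⟩ := hf.1 w hw
      have hxv : x ≠ v := by
        rintro rfl
        exact hv hx2
      exact ⟨x, hx, by rwa [Function.update_of_ne hxv]⟩
  have hle : Function.update f v 0 ≤ f := by
    intro w
    by_cases hw : w = v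
    · subst hw
      simp
    · simp [hw]
  simpa using (congrFun (hf.2 _ hrdf hle) v).symm

theorem injOn_assignment {V : Type*} (G : SimpleGraph V) :
    Set.InjOn assignment {f : V → Fin 3 | IsMinimalRDF G f} := by
  intro f hf g hg hfg
  have h2 (v : V) : f v = 2 ↔ g v = 2 := by
    rw [← inside_assignment, ← inside_assignment, hfg]
  ext1 v
  by_cases hv : f v = 2
  · rw [hv, (h2 v).1 hv]
  · have hv' : g v ≠ 2 := fun h ↦ hv ((h2 v).2 h)
    have h0 : f v = 0 ↔ g v = 0 := by
      rw [eq_zero_iff_of_isMinimalRDF hf hv, eq_zero_iff_of_isMinimalRDF hg hv']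
      simp only [h2]
    generalize f v = a at *
    generalize g v = b at *
    revert a b
    decide +revert

/-- The weights of a vertex to which nothing is attached. -/
def vertexWeights (q : ℝ) (x : VertexState) : ℝ :=
  if x = needy ∨ x = free then q else 0

theorem numMinRDF_mul_le {V : Type*} [Fintype V] (G : SimpleGraph V) {q : ℝ} (q0 : 0 ≤ q) :
    numMinRDF G * q ^ Fintype.card V ≤ partitionSum G fun _ ↦ vertexWeights q := by
  classical
  let s : Finset (V → Fin 3) := univ.filter (IsMinimalRDF G)
  have hs : numMinRDF G = s.card := by
    rw [numMinRDF, ← Set.ncard_coe_finset]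
    simp [s]
  have hinj : Set.InjOn assignment (s : Set (V → Fin 3)) := by
    simpa [s] using injOn_assignment G
  have hw (v : V) (f : V → Fin 3) : vertexWeights q (assignment f v) = q := by
    unfold assignment
    split_ifs <;> simp [vertexWeights]
  calc (numMinRDF G : ℝ) * q ^ Fintype.card V
      = ∑ f ∈ s, if Valid G (assignment f) then
          ∏ v, vertexWeights q (assignment f v) else 0 := by
        rw [sum_congr rfl fun f hf ↦ if_pos (valid_assignment (mem_filter.1 hf).2)]
        simp only [hw, prod_const, card_univ, sum_const, nsmul_eq_mul, hs, s]
    _ = ∑ σ ∈ s.image assignment, if Valid G σ then ∏ v, vertexWeights q (σ v) else 0 :=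
        by rw [sum_image hinj]
    _ ≤ _ := by
        refine sum_le_univ_sum_of_nonneg fun σ ↦ ?_
        split_ifs
        · exact prod_nonneg fun v _ ↦ by unfold vertexWeights; split_ifs <;> simp [q0]
        · exact le_rfl

end RomanForest

/-- Every forest of order `n` has at most `(√3)ⁿ` minimal Roman dominating functions. -/
theorem forest_numMinRDF_le {V : Type*} [Fintype V] (G : SimpleGraph V)
    (hG : G.IsAcyclic) :
    (numMinRDF G : ℝ) ≤ Real.sqrt 3 ^ (Fintype.card V) := by
  have h3 : 0 < Real.sqrt 3 := by positivity
  have hsq : Real.sqrt 3 ^ 2 = 3 := Real.sq_sqrt (by norm_num)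
  have q0 : 0 ≤ (Real.sqrt 3)⁻¹ := by positivity
  have hq : (Real.sqrt 3)⁻¹ ^ 2 = 1 / 3 := by rw [inv_pow, hsq]; norm_num
  have q1 : (Real.sqrt 3)⁻¹ ≤ 3 / 5 := by nlinarith
  have hadm : RomanForest.Admissible (Real.sqrt 3)⁻¹
      (RomanForest.vertexWeights (Real.sqrt 3)⁻¹) :=
    .inl (by constructor <;> simp [RomanForest.vertexWeights])
  have h := (RomanForest.numMinRDF_mul_le G q0).trans <|
    RomanForest.partitionSum_le_one hq q0 q1 hG
      (fun _ x ↦ by unfold RomanForest.vertexWeights; split_ifs <;> simp [q0])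
      (fun _ ↦ hadm.total_le_one q1) fun _ _ _ ↦ hadm
  rwa [inv_pow, ← div_eq_mul_inv, div_le_one (by positivity)] at h
end

section
/- Every interval graph of order n has at most (√3)^n minimal Roman dominating functions. -/
section OpenIrredundant

variable {V : Type*} {G : SimpleGraph V} {A P A' P' D : Finset V}

open Classical in
/-- The sets `D ⊆ A` in which every vertex has a private neighbor in `P \ D`. -/
noncomputable def openIrredundantSets (G : SimpleGraph V) (A P : Finset V) :
    Finset (Finset V) :=
  A.powerset.filter fun D => ∀ d ∈ D, ∃ p ∈ P, p ∉ D ∧ G.Adj d p ∧ ∀ e ∈ D, G.Adj e p → e = d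

theorem mem_openIrredundantSets :
    D ∈ openIrredundantSets G A P ↔ D ⊆ A ∧
      ∀ d ∈ D, ∃ p ∈ P, p ∉ D ∧ G.Adj d p ∧ ∀ e ∈ D, G.Adj e p → e = d := by
  simp [openIrredundantSets]

theorem openIrredundantSets_mono (hA : A ⊆ A') (hP : P ⊆ P') :
    openIrredundantSets G A P ⊆ openIrredundantSets G A' P' := by
  intro D hD
  rw [mem_openIrredundantSets] at hD ⊢
  refine ⟨hD.1.trans hA, fun d hd => ?_⟩
  obtain ⟨p, hp, h⟩ := hD.2 d hd
  exact ⟨p, hP hp, h⟩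

theorem card_openIrredundantSets_mono (hA : A ⊆ A') (hP : P ⊆ P') :
    ((openIrredundantSets G A P).card : ℝ) ≤ (openIrredundantSets G A' P').card := by
  exact_mod_cast Finset.card_le_card (openIrredundantSets_mono hA hP)

theorem mem_openIrredundantSets_of_disjoint (hD : D ∈ openIrredundantSets G A P)
    (hA : ∀ d ∈ D, d ∈ A') (hP : ∀ p ∈ P, ∀ d ∈ D, G.Adj d p → p ∈ P') :
    D ∈ openIrredundantSets G A' P' := by
  rw [mem_openIrredundantSets] at hD ⊢
  refine ⟨hA, fun d hd => ?_⟩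
  obtain ⟨p, hp, hpD, hdp, h⟩ := hD.2 d hd
  exact ⟨p, hP p hp d hd hdp, hpD, hdp, h⟩

/-- Vertices without neighbors on the other side can be discarded. -/
theorem card_openIrredundantSets_le_of_adj
    (h : ∀ a ∈ A, ∀ p ∈ P, G.Adj a p → a ∈ A' ∧ p ∈ P') :
    ((openIrredundantSets G A P).card : ℝ) ≤ (openIrredundantSets G A' P').card := by
  have : openIrredundantSets G A P ⊆ openIrredundantSets G A' P' := by
    intro D hD
    have hD' := mem_openIrredundantSets.1 hD
    refine mem_openIrredundantSets_of_disjoint hD (fun d hd => ?_) fun p hp d hd hdp => ?_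
    · obtain ⟨p, hp, -, hdp, -⟩ := hD'.2 d hd
      exact (h d (hD'.1 hd) p hp hdp).1
    · exact (h d (hD'.1 hd) p hp hdp).2
  exact_mod_cast Finset.card_le_card this

theorem openIrredundantSets_empty_left : (openIrredundantSets G ∅ P).card = 1 := by
  rw [Finset.card_eq_one]
  refine ⟨∅, ?_⟩
  ext D
  rw [mem_openIrredundantSets, Finset.mem_singleton, Finset.subset_empty]
  constructor
  · exact fun h => h.1
  · rintro rfl
    simp

theorem card_le_card_add_sum_of_erase_mem [DecidableEq V] {F F₀ : Finset (Finset V)}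
    (K : Finset V) (E : V → Finset (Finset V))
    (h : ∀ D ∈ F, D ∈ F₀ ∨ ∃ a ∈ K, a ∈ D ∧ D.erase a ∈ E a) :
    (F.card : ℝ) ≤ F₀.card + ∑ a ∈ K, ((E a).card : ℝ) := by
  have hsub : F ⊆ F₀ ∪ K.biUnion fun a => (E a).image (insert a) := by
    intro D hD
    rcases h D hD with h | ⟨a, ha, haD, hE⟩
    · exact Finset.mem_union_left _ h
    · refine Finset.mem_union_right _ (Finset.mem_biUnion.2 ⟨a, ha, Finset.mem_image.2 ⟨_, hE, ?_⟩⟩)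
      exact Finset.insert_erase haD
  have := (Finset.card_le_card hsub).trans (Finset.card_union_le _ _)
  have h2 : (K.biUnion fun a => (E a).image (insert a)).card ≤ ∑ a ∈ K, (E a).card :=
    Finset.card_biUnion_le.trans (Finset.sum_le_sum fun a _ => Finset.card_image_le)
  exact_mod_cast this.trans (Nat.add_le_add_left h2 _)

end OpenIrredundant

section Numeric

theorem sqrt_three_bounds :
    Real.sqrt 3 * Real.sqrt 3 = 3 ∧ 1.732 < Real.sqrt 3 ∧ Real.sqrt 3 < 1.7321 := by
  refine ⟨Real.mul_self_sqrt (by norm_num), ?_, ?_⟩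
  · exact Real.lt_sqrt_of_sq_lt (by norm_num)
  · rw [Real.sqrt_lt' (by norm_num)]
    norm_num

theorem sqrt_three_pow_mono {m n : ℕ} (h : m ≤ n) : Real.sqrt 3 ^ m ≤ Real.sqrt 3 ^ n :=
  pow_le_pow_right₀ (by linarith [sqrt_three_bounds.2.1]) h

theorem one_add_mul_le_sqrt_three_pow_succ (b : ℕ) :
    1 + ((b + 1 : ℕ) : ℝ) * (Real.sqrt 3 / 3) ≤ (1 + Real.sqrt 3) / 3 * Real.sqrt 3 ^ (b + 1) := by
  obtain ⟨h3, hl, hu⟩ := sqrt_three_bounds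
  induction b with
  | zero => norm_num; nlinarith
  | succ b ih =>
    rw [pow_succ, ← mul_assoc]
    have := mul_le_mul_of_nonneg_right ih (Real.sqrt_nonneg 3)
    refine le_trans ?_ this
    push_cast
    have hb : (0 : ℝ) ≤ b := b.cast_nonneg
    nlinarith [mul_nonneg hb (by linarith : (0 : ℝ) ≤ 1 - Real.sqrt 3 / 3)]

theorem one_add_mul_le_sqrt_three_pow (b : ℕ) :
    1 + (b : ℝ) * (Real.sqrt 3 / 3) ≤ Real.sqrt 3 ^ b := by
  cases b with
  | zero => simp
  | succ b =>
    refine (one_add_mul_le_sqrt_three_pow_succ b).trans ?_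
    have := sqrt_three_bounds
    exact mul_le_of_le_one_left (by positivity) (by linarith)

theorem add_le_sqrt_three_pow (k : ℕ) : 1.323 + ((k + 3 : ℕ) : ℝ) ≤ Real.sqrt 3 ^ (k + 3) := by
  obtain ⟨h3, hl, hu⟩ := sqrt_three_bounds
  induction k with
  | zero =>
    have : Real.sqrt 3 ^ 3 = 3 * Real.sqrt 3 := by rw [pow_succ, pow_two, h3]
    norm_num at this ⊢
    linarith
  | succ k ih =>
    rw [show k + 1 + 3 = (k + 3) + 1 from rfl, pow_succ]
    push_cast at ih ⊢
    have hk : (0 : ℝ) ≤ k := k.cast_nonneg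
    nlinarith

end Numeric

section Interval

variable {V : Type*} [DecidableEq V] {G : SimpleGraph V} {l r : V → ℝ} {A P D S : Finset V}

/-- `G` is the intersection graph of the intervals `[l v, r v]`. -/
structure IsIntervalModel (G : SimpleGraph V) (l r : V → ℝ) : Prop where
  le : ∀ v, l v ≤ r v
  adj_iff : ∀ u v, G.Adj u v ↔ u ≠ v ∧ l u ≤ r v ∧ l v ≤ r u

/-- Removing the leftmost vertex `a`, with private neighbor `p`, from an open irredundant set. -/
theorem IsIntervalModel.exists_erase_mem (hG : IsIntervalModel G l r) {a : V}
    (hD : D ∈ openIrredundantSets G A P) (ha : a ∈ D) (hmin : ∀ d ∈ D, l a ≤ l d) :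
    ∃ p ∈ P, G.Adj a p ∧ D.erase a ∈
      openIrredundantSets G (A.filter fun v => r p < l v) (P.filter fun v => r a < l v) := by
  rw [mem_openIrredundantSets] at hD
  obtain ⟨hDA, hD⟩ := hD
  obtain ⟨p, hpP, hpD, hap, hp⟩ := hD a ha
  have key : ∀ d ∈ D, d ≠ a → ∀ q, q ∉ D → G.Adj d q → (∀ e ∈ D, G.Adj e q → e = d) →
      r a < l q := by
    intro d hd hda q hqD hdq hq
    by_contra! hlt
    have haq : ¬ G.Adj a q := fun h => hda (hq a ha h).symm
    rw [hG.adj_iff] at haq hdq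
    exact haq ⟨fun h => hqD (h ▸ ha), (hmin d hd).trans hdq.2.1, hlt⟩
  refine ⟨p, hpP, hap, mem_openIrredundantSets.2 ⟨fun d hd => ?_, fun d hd => ?_⟩⟩
  · obtain ⟨hda, hd⟩ := Finset.mem_erase.1 hd
    refine Finset.mem_filter.2 ⟨hDA hd, ?_⟩
    obtain ⟨q, -, hqD, hdq, hq⟩ := hD d hd
    have h1 := key d hd hda q hqD hdq hq
    by_contra! hlt
    have hdp : ¬ G.Adj d p := fun h => hda (hp d hd h)
    rw [hG.adj_iff] at hdp hap hdq
    exact hdp ⟨fun h => hpD (h ▸ hd), hlt, by linarith [hap.2.2, hdq.2.2]⟩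
  · obtain ⟨hda, hd⟩ := Finset.mem_erase.1 hd
    obtain ⟨q, hqP, hqD, hdq, hq⟩ := hD d hd
    exact ⟨q, Finset.mem_filter.2 ⟨hqP, key d hd hda q hqD hdq hq⟩,
      fun h => hqD (Finset.mem_of_mem_erase h), hdq,
      fun e he => hq e (Finset.mem_of_mem_erase he)⟩

/-- Bounds on the number of open irredundant sets, proved by simultaneous induction. -/
structure OpenIrredundantBounds (G : SimpleGraph V) (l : V → ℝ) (A P : Finset V) : Prop where
  eq : A = P → ((openIrredundantSets G A P).card : ℝ) ≤ Real.sqrt 3 ^ P.card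
  supset : P ⊆ A → (∀ a ∈ A \ P, ∀ p ∈ P, l a ≤ l p) →
    ((openIrredundantSets G A P).card : ℝ) ≤
      Real.sqrt 3 ^ P.card * (1 + (A \ P).card * (Real.sqrt 3 / 3))
  subset : A ⊆ P → (∀ p ∈ P \ A, ∀ a ∈ A, l p ≤ l a) →
    ((openIrredundantSets G A P).card : ℝ) ≤ 1.323 * Real.sqrt 3 ^ A.card

/-- The bounds hold for all pairs of total size below `N`. -/
def OpenIrredundantBoundsBelow (G : SimpleGraph V) (l : V → ℝ) (N : ℕ) : Prop :=
  ∀ A P : Finset V, A.card + P.card < N → OpenIrredundantBounds G l A P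

theorem OpenIrredundantBoundsBelow.mono {M N : ℕ} (h : OpenIrredundantBoundsBelow G l N)
    (hMN : M ≤ N) : OpenIrredundantBoundsBelow G l M :=
  fun A P hAP => h A P (hAP.trans_le hMN)

namespace OpenIrredundantBoundsBelow

variable {N : ℕ}

theorem card_supset_le (h : OpenIrredundantBoundsBelow G l N) (hPA : P ⊆ A)
    (hl : ∀ a ∈ A \ P, ∀ p ∈ P, l a ≤ l p) (hN : A.card + P.card < N) :
    ((openIrredundantSets G A P).card : ℝ) ≤ Real.sqrt 3 ^ A.card := by
  refine ((h A P hN).supset hPA hl).trans ?_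
  rw [← Finset.card_sdiff_add_card_eq_card hPA, pow_add, mul_comm]
  gcongr
  exact one_add_mul_le_sqrt_three_pow _

theorem card_ssupset_le (h : OpenIrredundantBoundsBelow G l N) (hPA : P ⊂ A)
    (hl : ∀ a ∈ A \ P, ∀ p ∈ P, l a ≤ l p) (hN : A.card + P.card < N) :
    ((openIrredundantSets G A P).card : ℝ) ≤ (1 + Real.sqrt 3) / 3 * Real.sqrt 3 ^ A.card := by
  refine ((h A P hN).supset hPA.1 hl).trans ?_
  have hpos : 0 < (A \ P).card := Finset.card_pos.2 (Finset.sdiff_nonempty.2 hPA.2)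
  obtain ⟨b, hb⟩ := Nat.exists_eq_succ_of_ne_zero hpos.ne'
  rw [← Finset.card_sdiff_add_card_eq_card hPA.1, pow_add, mul_comm, hb, ← mul_assoc]
  gcongr
  exact one_add_mul_le_sqrt_three_pow_succ b

theorem card_eq_le (h : OpenIrredundantBoundsBelow G l N) (hN : S.card + S.card < N) :
    ((openIrredundantSets G S S).card : ℝ) ≤ Real.sqrt 3 ^ S.card :=
  (h S S hN).eq rfl

theorem card_filter_le_of_le (h : OpenIrredundantBoundsBelow G l N) {q x : ℝ} (hqx : q ≤ x)
    (hN : (S.filter fun v => q < l v).card + (S.filter fun v => q < l v).card < N) :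
    ((openIrredundantSets G (S.filter fun v => q < l v)
      (S.filter fun v => x < l v)).card : ℝ) ≤
      Real.sqrt 3 ^ (S.filter fun v => q < l v).card := by
  have hsub : (S.filter fun v => x < l v) ⊆ S.filter fun v => q < l v :=
    Finset.monotone_filter_right _ fun v _ hv => lt_of_le_of_lt hqx hv
  refine h.card_supset_le hsub (fun a ha p hp => ?_) ?_
  · simp only [Finset.mem_sdiff, Finset.mem_filter, not_and, not_lt] at ha hp
    exact (ha.2 ha.1.1).trans hp.2.le
  · have := Finset.card_le_card hsub
    omega

theorem card_filter_le_of_ge (h : OpenIrredundantBoundsBelow G l N) {q x : ℝ} (hqx : x ≤ q)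
    (hN : (S.filter fun v => x < l v).card + (S.filter fun v => x < l v).card < N) :
    ((openIrredundantSets G (S.filter fun v => q < l v)
      (S.filter fun v => x < l v)).card : ℝ) ≤
      Real.sqrt 3 ^ (S.filter fun v => x < l v).card :=
  (card_openIrredundantSets_mono
    (Finset.monotone_filter_right _ fun _ _ hv => lt_of_le_of_lt hqx hv) subset_rfl).trans
    (h.card_eq_le hN)

/-- The case of a set of candidates that contains all possible private neighbors. -/
theorem supset (hG : IsIntervalModel G l r)
    (h : OpenIrredundantBoundsBelow G l (A.card + P.card)) (hne : P ≠ A) (hPA : P ⊆ A)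
    (hl : ∀ a ∈ A \ P, ∀ p ∈ P, l a ≤ l p) :
    ((openIrredundantSets G A P).card : ℝ) ≤
      Real.sqrt 3 ^ P.card * (1 + (A \ P).card * (Real.sqrt 3 / 3)) := by
  have hcard : P.card < A.card := Finset.card_lt_card (hPA.ssubset_of_ne hne)
  have hex : ∀ a ∈ A \ P, ∃ E : Finset (Finset V),
      (E.card : ℝ) ≤ Real.sqrt 3 ^ P.card * (Real.sqrt 3 / 3) ∧
      ∀ D ∈ openIrredundantSets G A P, a ∈ D → (∀ d ∈ D, l a ≤ l d) → D.erase a ∈ E := by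
    intro a ha
    rcases (P.filter fun p => l p ≤ r a).eq_empty_or_nonempty with hB | hB
    · refine ⟨∅, by simp; positivity, fun D hD haD hmin => ?_⟩
      obtain ⟨p, hp, hap, -⟩ := hG.exists_erase_mem hD haD hmin
      have : p ∈ P.filter fun p => l p ≤ r a :=
        Finset.mem_filter.2 ⟨hp, ((hG.adj_iff _ _).1 hap).2.2⟩
      simp [hB] at this
    · obtain ⟨p, hp, hpmin⟩ := Finset.exists_min_image _ r hB
      rw [Finset.mem_filter] at hp
      refine ⟨openIrredundantSets G (P.filter fun v => r p < l v)
        (P.filter fun v => r a < l v), ?_, fun D hD haD hmin => ?_⟩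
      · have hlt : ∀ x, l p ≤ x → (P.filter fun v => x < l v).card + 1 ≤ P.card := by
          intro x hx
          refine Finset.card_lt_card ⟨Finset.filter_subset _ _, fun hs => ?_⟩
          have := (Finset.mem_filter.1 (hs hp.1)).2
          linarith
        have hpow : ∀ m, m + 1 ≤ P.card →
            Real.sqrt 3 ^ m ≤ Real.sqrt 3 ^ P.card * (Real.sqrt 3 / 3) := by
          intro m hm
          have h1 := sqrt_three_pow_mono hm
          have h3 := sqrt_three_bounds.1
          rw [pow_succ] at h1
          have h2 := mul_le_mul_of_nonneg_right h1 (Real.sqrt_nonneg 3)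
          rw [mul_assoc, h3] at h2
          linarith
        rcases le_total (r p) (r a) with hle | hle
        · have := hlt _ (hG.le p)
          exact (h.card_filter_le_of_le hle (by omega)).trans (hpow _ this)
        · have := hlt _ hp.2
          exact (h.card_filter_le_of_ge hle (by omega)).trans (hpow _ this)
      · obtain ⟨q, hq, haq, hE⟩ := hG.exists_erase_mem hD haD hmin
        have hpq : r p ≤ r q :=
          hpmin q (Finset.mem_filter.2 ⟨hq, ((hG.adj_iff _ _).1 haq).2.2⟩)
        refine openIrredundantSets_mono (fun v hv => ?_) subset_rfl hE
        rw [Finset.mem_filter] at hv ⊢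
        refine ⟨?_, hpq.trans_lt hv.2⟩
        by_contra hvP
        have := hl v (Finset.mem_sdiff.2 ⟨hv.1, hvP⟩) q hq
        linarith [hG.le q]
  choose! E hE hmem using hex
  have hcov := card_le_card_add_sum_of_erase_mem (F := openIrredundantSets G A P)
    (F₀ := openIrredundantSets G P P) (A \ P) E fun D hD => by
      have hDA := (mem_openIrredundantSets.1 hD).1
      rcases (D \ P).eq_empty_or_nonempty with hDP | hDP
      · exact Or.inl (mem_openIrredundantSets_of_disjoint hD
          (Finset.sdiff_eq_empty_iff_subset.1 hDP) fun p hp _ _ _ => hp)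
      · obtain ⟨a, ha, hmin⟩ := Finset.exists_min_image _ l hDP
        rw [Finset.mem_sdiff] at ha
        have haA : a ∈ A \ P := Finset.mem_sdiff.2 ⟨hDA ha.1, ha.2⟩
        refine Or.inr ⟨a, haA, ha.1, hmem a haA D hD ha.1 fun d hd => ?_⟩
        by_cases hdP : d ∈ P
        · exact hl a haA d hdP
        · exact hmin d (Finset.mem_sdiff.2 ⟨hd, hdP⟩)
  have hsum := Finset.sum_le_card_nsmul _ _ _ hE
  rw [nsmul_eq_mul] at hsum
  have hP := h.card_eq_le (S := P) (by omega)
  linarith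

/-- Branch on the leftmost candidate. -/
theorem card_le_add_erase (hG : IsIntervalModel G l r) {a : V} (ha : a ∈ A)
    (hmin : ∀ d ∈ A, l a ≤ l d) (hl : ∀ p ∈ P \ A, ∀ a ∈ A, l p ≤ l a) :
    ((openIrredundantSets G A P).card : ℝ) ≤ (openIrredundantSets G (A.erase a) P).card +
      (openIrredundantSets G (A.erase a) ((A.erase a).filter fun v => r a < l v)).card := by
  have hcov := card_le_card_add_sum_of_erase_mem (F := openIrredundantSets G A P)
    (F₀ := openIrredundantSets G (A.erase a) P) {a}
    (fun a => openIrredundantSets G (A.erase a) ((A.erase a).filter fun v => r a < l v))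
    fun D hD => by
      have hDA := (mem_openIrredundantSets.1 hD).1
      by_cases haD : a ∈ D
      · refine Or.inr ⟨a, Finset.mem_singleton_self a, haD, ?_⟩
        obtain ⟨q, hq, haq, hE⟩ := hG.exists_erase_mem hD haD fun d hd => hmin d (hDA hd)
        have hq := ((hG.adj_iff _ _).1 haq).2.1
        refine openIrredundantSets_mono (fun v hv => ?_) (fun v hv => ?_) hE
        · rw [Finset.mem_filter] at hv
          refine Finset.mem_erase.2 ⟨?_, hv.1⟩
          rintro rfl
          linarith
        · rw [Finset.mem_filter] at hv ⊢
          refine ⟨Finset.mem_erase.2 ⟨?_, ?_⟩, hv.2⟩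
          · rintro rfl
            linarith [hG.le v]
          · by_contra hvA
            have := hl v (Finset.mem_sdiff.2 ⟨hv.1, hvA⟩) a ha
            linarith [hG.le a]
      · exact Or.inl (mem_openIrredundantSets_of_disjoint hD
          (fun d hd => Finset.mem_erase.2 ⟨fun h => haD (h ▸ hd), hDA hd⟩) fun p hp _ _ _ => hp)
  simpa using hcov

theorem card_filter_right_le (h : OpenIrredundantBoundsBelow G l N) (x : ℝ)
    (hN : S.card + S.card < N) :
    ((openIrredundantSets G S (S.filter fun v => x < l v)).card : ℝ) ≤
      (1 + Real.sqrt 3) / 3 * Real.sqrt 3 ^ S.card ∨ ∀ v ∈ S, x < l v := by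
  by_cases hx : ∀ v ∈ S, x < l v
  · exact Or.inr hx
  · refine Or.inl (h.card_ssupset_le ⟨Finset.filter_subset _ _, fun hs => ?_⟩
      (fun a ha p hp => ?_) ?_)
    · exact hx fun v hv => (Finset.mem_filter.1 (hs hv)).2
    · simp only [Finset.mem_sdiff, Finset.mem_filter, not_and, not_lt] at ha hp
      exact (ha.2 ha.1).trans hp.2.le
    · have := Finset.card_le_card (Finset.filter_subset (fun v => x < l v) S)
      omega

/-- The case of a set of possible private neighbors that contains all candidates. -/
theorem subset (hG : IsIntervalModel G l r)
    (h : OpenIrredundantBoundsBelow G l (A.card + P.card)) (hAP : A ⊆ P)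
    (hl : ∀ p ∈ P \ A, ∀ a ∈ A, l p ≤ l a) :
    ((openIrredundantSets G A P).card : ℝ) ≤ 1.323 * Real.sqrt 3 ^ A.card := by
  obtain ⟨h3, hs, hs'⟩ := sqrt_three_bounds
  have hAPc := Finset.card_le_card hAP
  rcases A.eq_empty_or_nonempty with rfl | hA
  · rw [openIrredundantSets_empty_left]
    norm_num
  obtain ⟨a, ha, hamin⟩ := Finset.exists_min_image A l hA
  have hc := Finset.card_erase_add_one ha
  have hl₁ : ∀ p ∈ P \ A.erase a, ∀ b ∈ A.erase a, l p ≤ l b := by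
    intro p hp b hb
    have hbA := Finset.mem_of_mem_erase hb
    by_cases hpa : p = a
    · exact hpa ▸ hamin b hbA
    · refine hl p ?_ b hbA
      simp only [Finset.mem_sdiff, Finset.mem_erase] at hp ⊢
      exact ⟨hp.1, fun h => hp.2 ⟨hpa, h⟩⟩
  have hsub₁ : A.erase a ⊆ P := (Finset.erase_subset _ _).trans hAP
  have hbr := card_le_add_erase hG ha hamin hl
  rw [← hc, pow_succ]
  have hpos : 0 < Real.sqrt 3 ^ (A.erase a).card := by positivity
  have h₁ := (h (A.erase a) P (by omega)).subset hsub₁ hl₁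
  rcases h.card_filter_right_le (S := A.erase a) (r a) (by omega) with hb | hb
  · nlinarith
  rw [Finset.filter_true_of_mem hb] at hbr
  have hfull := h.card_eq_le (S := A.erase a) (by omega)
  rcases (A.erase a).eq_empty_or_nonempty with hA₁ | hA₁
  · rw [hA₁, openIrredundantSets_empty_left, openIrredundantSets_empty_left] at hbr
    rw [hA₁]
    simp only [Finset.card_empty, pow_zero, Nat.cast_one] at hbr ⊢
    linarith
  obtain ⟨b, hbA, hbmin⟩ := Finset.exists_min_image _ l hA₁
  have hc₂ := Finset.card_erase_add_one hbA
  have hl₂ : ∀ p ∈ P \ (A.erase a).erase b, ∀ v ∈ (A.erase a).erase b, l p ≤ l v := by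
    intro p hp v hv
    have hvA := Finset.mem_of_mem_erase hv
    by_cases hpb : p = b
    · exact hpb ▸ hbmin v hvA
    · refine hl₁ p ?_ v hvA
      rw [Finset.mem_sdiff] at hp ⊢
      exact ⟨hp.1, fun h => hp.2 (Finset.mem_erase.2 ⟨hpb, h⟩)⟩
  have hbr₂ := card_le_add_erase hG hbA hbmin hl₁
  have h₂ := (h ((A.erase a).erase b) P (by omega)).subset
    ((Finset.erase_subset _ _).trans hsub₁) hl₂
  rw [← hc₂, pow_succ] at hfull ⊢
  have hpos₂ : 0 < Real.sqrt 3 ^ ((A.erase a).erase b).card := by positivity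
  rw [mul_assoc, h3]
  rcases h.card_filter_right_le (S := (A.erase a).erase b) (r b) (by omega) with hb₂ | hb₂
  · nlinarith
  rw [Finset.filter_true_of_mem hb₂] at hbr₂
  have hfull₂ := h.card_eq_le (S := (A.erase a).erase b) (by omega)
  have hiso : ((openIrredundantSets G (A.erase a) (A.erase a)).card : ℝ) ≤
      (openIrredundantSets G ((A.erase a).erase b) ((A.erase a).erase b)).card := by
    refine card_openIrredundantSets_le_of_adj fun u hu v hv huv => ?_
    rw [hG.adj_iff] at huv
    have hub : u ≠ b := by
      rintro rfl
      have := hb₂ v (Finset.mem_erase.2 ⟨huv.1.symm, hv⟩)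
      linarith [huv.2.2]
    have hvb : v ≠ b := by
      rintro rfl
      have := hb₂ u (Finset.mem_erase.2 ⟨huv.1, hu⟩)
      linarith [huv.2.1]
    exact ⟨Finset.mem_erase.2 ⟨hub, hu⟩, Finset.mem_erase.2 ⟨hvb, hv⟩⟩
  linarith

/-- Branch on the closed neighborhood of the vertex `a` whose interval ends first. -/
theorem card_le_add_sum_add (hG : IsIntervalModel G l r) {a : V} {q : ℝ} (ha : a ∈ S)
    (hmin : ∀ d ∈ S, r a ≤ r d) (hq : ∀ p ∈ S, G.Adj a p → q ≤ r p) :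
    ((openIrredundantSets G S S).card : ℝ) ≤
      (openIrredundantSets G (S.filter fun v => r a < l v) (S.erase a)).card +
      ((openIrredundantSets G (S.filter fun v => q < l v)
          (S.filter fun v => r a < l v)).card +
        ∑ u ∈ (S.filter fun v => l v ≤ r a).erase a,
          ((openIrredundantSets G (S.filter fun v => r a < l v)
            (S.filter fun v => r u < l v)).card : ℝ)) := by
  have haK : a ∈ S.filter fun v => l v ≤ r a := Finset.mem_filter.2 ⟨ha, hG.le a⟩
  have hcov := card_le_card_add_sum_of_erase_mem (F := openIrredundantSets G S S)
    (F₀ := openIrredundantSets G (S.filter fun v => r a < l v) (S.erase a))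
    (S.filter fun v => l v ≤ r a)
    (fun u => if u = a then openIrredundantSets G (S.filter fun v => q < l v)
        (S.filter fun v => r a < l v)
      else openIrredundantSets G (S.filter fun v => r a < l v) (S.filter fun v => r u < l v))
    fun D hD => by
      have hDS := (mem_openIrredundantSets.1 hD).1
      by_cases hR : ∀ d ∈ D, r a < l d
      · refine Or.inl (mem_openIrredundantSets_of_disjoint hD
          (fun d hd => Finset.mem_filter.2 ⟨hDS hd, hR d hd⟩) fun p hp d hd hdp =>
            Finset.mem_erase.2 ⟨?_, hp⟩)
        rintro rfl
        exact (hR d hd).not_ge ((hG.adj_iff _ _).1 hdp).2.1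
      · push Not at hR
        obtain ⟨d, hd, hda⟩ := hR
        obtain ⟨u, hu, humin⟩ := Finset.exists_min_image D l ⟨d, hd⟩
        refine Or.inr ⟨u, Finset.mem_filter.2 ⟨hDS hu, (humin d hd).trans hda⟩, hu, ?_⟩
        obtain ⟨p, hp, hup, hE⟩ := hG.exists_erase_mem hD hu humin
        split_ifs with hua
        · subst hua
          exact openIrredundantSets_mono
            (Finset.monotone_filter_right _ fun v _ hv => (hq p hp hup).trans_lt hv) subset_rfl hE
        · exact openIrredundantSets_mono
            (Finset.monotone_filter_right _ fun v _ hv => (hmin p hp).trans_lt hv) subset_rfl hE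
  rw [← Finset.add_sum_erase _ _ haK, if_pos rfl] at hcov
  refine hcov.trans (le_of_eq ?_)
  congr 2
  refine Finset.sum_congr rfl fun u hu => ?_
  rw [if_neg (Finset.ne_of_mem_erase hu)]

/-- The case in which candidates and possible private neighbors agree. -/
theorem eq (hG : IsIntervalModel G l r)
    (h : OpenIrredundantBoundsBelow G l (S.card + S.card)) :
    ((openIrredundantSets G S S).card : ℝ) ≤ Real.sqrt 3 ^ S.card := by
  obtain ⟨h3, hs, hs'⟩ := sqrt_three_bounds
  rcases S.eq_empty_or_nonempty with rfl | hS
  · rw [openIrredundantSets_empty_left]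
    norm_num
  obtain ⟨a, ha, hmin⟩ := Finset.exists_min_image S r hS
  have hKR : (S.filter fun v => l v ≤ r a).card + (S.filter fun v => r a < l v).card = S.card := by
    simpa only [not_le] using
      Finset.card_filter_add_card_filter_not (s := S) (fun v => l v ≤ r a)
  have haK : a ∈ S.filter fun v => l v ≤ r a := Finset.mem_filter.2 ⟨ha, hG.le a⟩
  have hK := Finset.card_erase_add_one haK
  have hRsub : (S.filter fun v => r a < l v) ⊆ S.erase a := fun v hv => by
    rw [Finset.mem_filter] at hv
    refine Finset.mem_erase.2 ⟨?_, hv.1⟩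
    rintro rfl
    linarith [hG.le v]
  have hpriv := (h (S.filter fun v => r a < l v) (S.erase a) (by
    have := Finset.card_erase_add_one ha
    omega)).subset hRsub fun p hp v hv => by
      simp only [Finset.mem_sdiff, Finset.mem_filter, Finset.mem_erase, not_and, not_lt] at hp hv
      exact (hp.2 hp.1.2).trans hv.2.le
  have hright : ∀ u ∈ (S.filter fun v => l v ≤ r a).erase a,
      ((openIrredundantSets G (S.filter fun v => r a < l v)
        (S.filter fun v => r u < l v)).card : ℝ) ≤
        Real.sqrt 3 ^ (S.filter fun v => r a < l v).card := fun u hu => by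
    have hu := (Finset.mem_filter.1 (Finset.mem_of_mem_erase hu)).1
    exact h.card_filter_le_of_le (hmin u hu) (by omega)
  have hpos : 0 < Real.sqrt 3 ^ (S.filter fun v => r a < l v).card := by positivity
  have hadjK : ∀ p ∈ S, G.Adj a p → p ∈ (S.filter fun v => l v ≤ r a).erase a :=
    fun p hp hap => by
      rw [hG.adj_iff] at hap
      exact Finset.mem_erase.2 ⟨hap.1.symm, Finset.mem_filter.2 ⟨hp, hap.2.2⟩⟩
  rcases hk : ((S.filter fun v => l v ≤ r a).erase a).card with _ | _ | k
  · have hiso : ((openIrredundantSets G S S).card : ℝ) ≤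
        (openIrredundantSets G (S.erase a) (S.erase a)).card := by
      rw [Finset.card_eq_zero] at hk
      refine card_openIrredundantSets_le_of_adj fun u hu v hv huv =>
        ⟨Finset.mem_erase.2 ⟨?_, hu⟩, Finset.mem_erase.2 ⟨?_, hv⟩⟩
      · rintro rfl
        simpa [hk] using hadjK v hv huv
      · rintro rfl
        simpa [hk] using hadjK u hu huv.symm
    have hc := Finset.card_erase_add_one ha
    exact (hiso.trans (h.card_eq_le (by omega))).trans (sqrt_three_pow_mono (by omega))
  · obtain ⟨u, hu⟩ := Finset.card_eq_one.1 hk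
    have huS : u ∈ S.filter fun v => l v ≤ r a :=
      Finset.mem_of_mem_erase (hu ▸ Finset.mem_singleton_self u)
    rw [Finset.mem_filter] at huS
    have hbr := card_le_add_sum_add hG (q := r u) ha hmin fun p hp hap => by
      have := hadjK p hp hap
      rw [hu, Finset.mem_singleton] at this
      rw [this]
    rw [hu, Finset.sum_singleton] at hbr
    rw [← hKR, ← hK, hk, pow_add, pow_add, zero_add, pow_one, h3]
    by_cases hb : ∀ v ∈ S, r a < l v → r u < l v
    · have hfilter : (S.filter fun v => r u < l v) = S.filter fun v => r a < l v :=
        Finset.filter_congr fun v hv => ⟨(hmin u huS.1).trans_lt, hb v hv⟩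
      have hR := h.card_eq_le (S := S.filter fun v => r a < l v) (by omega)
      rw [hfilter] at hbr
      have : ((openIrredundantSets G (S.filter fun v => r a < l v) (S.erase a)).card : ℝ) ≤
          (openIrredundantSets G (S.filter fun v => r a < l v)
            (S.filter fun v => r a < l v)).card := by
        refine card_openIrredundantSets_le_of_adj fun v hv p hp hvp => ⟨hv, ?_⟩
        rw [Finset.mem_filter] at hv
        obtain ⟨hpa, hp⟩ := Finset.mem_erase.1 hp
        refine Finset.mem_filter.2 ⟨hp, ?_⟩
        by_contra! hlt
        have hpu : p ∈ (S.filter fun v => l v ≤ r a).erase a :=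
          Finset.mem_erase.2 ⟨hpa, Finset.mem_filter.2 ⟨hp, hlt⟩⟩
        rw [hu, Finset.mem_singleton] at hpu
        subst hpu
        exact (hb v hv.1 hv.2).not_ge ((hG.adj_iff _ _).1 hvp).2.1
      linarith
    · push Not at hb
      obtain ⟨v, hv, hav, hvu⟩ := hb
      have hss : (S.filter fun v => r u < l v) ⊂ S.filter fun v => r a < l v :=
        ⟨Finset.monotone_filter_right _ fun v _ hv => (hmin u huS.1).trans_lt hv, fun hs =>
          hvu.not_gt (Finset.mem_filter.1 (hs (Finset.mem_filter.2 ⟨hv, hav⟩))).2⟩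
      have hlt := Finset.card_lt_card hss
      have hsep : ∀ p ∈ (S.filter fun v => r a < l v) \ S.filter fun v => r u < l v,
          ∀ d ∈ S.filter fun v => r u < l v, l p ≤ l d := fun p hp d hd => by
        simp only [Finset.mem_sdiff, Finset.mem_filter, not_and, not_lt] at hp hd
        exact (hp.2 hp.1.1).trans hd.2.le
      have h₁ := h.card_ssupset_le hss hsep (by omega)
      have h₂ := (h (S.filter fun v => r u < l v) (S.filter fun v => r a < l v)
        (by omega)).subset hss.1 hsep
      have h₄ := sqrt_three_pow_mono hlt
      rw [Nat.succ_eq_add_one, pow_succ] at h₄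
      have h₅ := mul_le_mul_of_nonneg_right h₄ (Real.sqrt_nonneg 3)
      rw [mul_assoc, h3] at h₅
      nlinarith
  · have hbr := card_le_add_sum_add hG (q := r a) ha hmin fun p hp _ => hmin p hp
    have hsum := Finset.sum_le_card_nsmul _ _ _ hright
    rw [nsmul_eq_mul, hk] at hsum
    have hR := h.card_eq_le (S := S.filter fun v => r a < l v) (by omega)
    rw [← hKR, ← hK, hk, pow_add]
    have := mul_le_mul_of_nonneg_right (add_le_sqrt_three_pow k) hpos.le
    push_cast at this hsum
    linarith

end OpenIrredundantBoundsBelow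

theorem IsIntervalModel.openIrredundantBounds (hG : IsIntervalModel G l r) (A P : Finset V) :
    OpenIrredundantBounds G l A P := by
  suffices ∀ N, OpenIrredundantBoundsBelow G l N from this _ A P (Nat.lt_succ_self _)
  intro N
  induction N with
  | zero => exact fun _ _ h => absurd h (Nat.not_lt_zero _)
  | succ N ih =>
    intro A P hAP
    have h := ih.mono (Nat.lt_succ_iff.1 hAP)
    refine ⟨?_, fun hPA hl => ?_, h.subset hG⟩
    · rintro rfl
      exact h.eq hG
    · by_cases hne : P = A
      · subst hne
        simpa using h.eq hG
      · exact h.supset hG hne hPA hl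

end Interval

section RomanDomination

variable {V : Type*} {G : SimpleGraph V}

theorem IsMinimalRDF.eq_zero_iff {f : V → Fin 3} (hf : IsMinimalRDF G f) (v : V) :
    f v = 0 ↔ f v ≠ 2 ∧ ∃ u, G.Adj v u ∧ f u = 2 := by
  classical
  refine ⟨fun h => ⟨by simp [h], hf.1 v h⟩, fun ⟨hv, u, hvu, hu⟩ => ?_⟩
  have hg := hf.2 (Function.update f v 0) (fun w hw => ?_) ?_
  · rw [← hg, Function.update_self]
  · by_cases hwv : w = v
    · subst hwv
      exact ⟨u, hvu, by rw [Function.update_of_ne hvu.ne', hu]⟩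
    · rw [Function.update_of_ne hwv] at hw
      obtain ⟨x, hwx, hx⟩ := hf.1 w hw
      exact ⟨x, hwx, by rw [Function.update_of_ne (by rintro rfl; exact hv hx), hx]⟩
  · exact update_le_self_iff.2 (Fin.zero_le _)

theorem IsMinimalRDF.mem_openIrredundantSets [Fintype V] {f : V → Fin 3}
    (hf : IsMinimalRDF G f) :
    (Finset.univ.filter fun v => f v = 2) ∈ openIrredundantSets G Finset.univ Finset.univ := by
  classical
  refine _root_.mem_openIrredundantSets.2 ⟨Finset.subset_univ _, fun d hd => ?_⟩
  simp only [Finset.mem_filter, Finset.mem_univ, true_and] at hd ⊢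
  have hg : ¬ IsRDF G (Function.update f d 1) := fun hg => by
    have := hf.2 _ hg (update_le_self_iff.2 (by rw [hd]; decide))
    have := congrFun this d
    rw [Function.update_self, hd] at this
    exact absurd this (by decide)
  simp only [IsRDF, not_forall, not_exists, not_and] at hg
  obtain ⟨w, hw, hwu⟩ := hg
  have hwd : w ≠ d := by
    rintro rfl
    simp at hw
  rw [Function.update_of_ne hwd] at hw
  have huniq : ∀ e, f e = 2 → G.Adj e w → e = d := fun e he hew => by
    by_contra hed
    exact hwu e hew.symm (by rw [Function.update_of_ne hed, he])
  obtain ⟨u, hwu, hu⟩ := hf.1 w hw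
  exact ⟨w, by simp [hw], huniq u hu hwu.symm ▸ hwu.symm, huniq⟩

theorem numMinRDF_le_card_openIrredundantSets [Fintype V] (G : SimpleGraph V) :
    numMinRDF G ≤ (openIrredundantSets G Finset.univ Finset.univ).card := by
  classical
  rw [← Set.ncard_coe_finset]
  refine Set.ncard_le_ncard_of_injOn (fun f : V → Fin 3 => Finset.univ.filter fun v => f v = 2)
    (fun f hf => hf.mem_openIrredundantSets) (fun f hf g hg hfg => ?_) (Finset.finite_toSet _)
  have h2 : ∀ v, f v = 2 ↔ g v = 2 := fun v => by
    simpa using Finset.ext_iff.1 hfg v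
  have h0 : ∀ v, f v = 0 ↔ g v = 0 := fun v => by
    rw [hf.eq_zero_iff, hg.eq_zero_iff]
    simp only [h2, ne_eq]
  funext v
  have h2 := h2 v
  have h0 := h0 v
  generalize f v = x at h0 h2
  generalize g v = y at h0 h2
  revert x y
  decide

end RomanDomination

/-- Every interval graph of order `n` has at most `(√3)ⁿ` minimal Roman dominating
functions. An interval graph is given by real intervals `[l v, r v]` such that distinct
vertices are adjacent iff their intervals intersect. -/
theorem intervalGraph_numMinRDF_le {V : Type*} [Fintype V] (G : SimpleGraph V)
    (l r : V → ℝ) (hlr : ∀ v, l v ≤ r v)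
    (hadj : ∀ u v : V, u ≠ v →
      (G.Adj u v ↔ (Set.Icc (l u) (r u) ∩ Set.Icc (l v) (r v)).Nonempty)) :
    (numMinRDF G : ℝ) ≤ Real.sqrt 3 ^ (Fintype.card V) := by
  classical
  have hG : IsIntervalModel G l r := by
    refine ⟨hlr, fun u v => ?_⟩
    by_cases huv : u = v
    · simp [huv]
    · rw [hadj u v huv, Set.Icc_inter_Icc, Set.nonempty_Icc]
      simp [huv, hlr, and_comm]
  have h := (hG.openIrredundantBounds Finset.univ Finset.univ).eq rfl
  rw [Finset.card_univ] at h
  exact le_trans (by exact_mod_cast numMinRDF_le_card_openIrredundantSets G) h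
end

section
/- There exists a constant C > 0 such that every chordal graph of order n has at most C · 1.8940^n minimal Roman dominating functions. -/
/-- A chordal graph: no induced cycle of length at least four, i.e. for every `n ≥ 4`
there is no (induced-subgraph) embedding of the `n`-cycle. -/
def IsChordal {V : Type*} (G : SimpleGraph V) : Prop :=
  ∀ n : ℕ, 4 ≤ n → IsEmpty (SimpleGraph.cycleGraph n ↪g G)

section Dirac
variable {V : Type*} {G : SimpleGraph V}

theorem cycleGraph_adj_iff_of_lt {n : ℕ} {i j : Fin n} (hij : i < j) :
    (SimpleGraph.cycleGraph n).Adj i j ↔ i.val + 1 = j.val ∨ (i.val = 0 ∧ j.val + 1 = n) := by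
  obtain ⟨i, hi⟩ := i
  obtain ⟨j, hj⟩ := j
  simp only [Fin.mk_lt_mk] at hij
  rw [SimpleGraph.cycleGraph_adj']
  simp only [Fin.sub_def]
  have h1 : (n - j + i) % n = n - j + i := Nat.mod_eq_of_lt (by omega)
  have h2 : (n - i + j) % n = j - i := by
    rw [show n - i + j = (j - i) + n by omega, Nat.add_mod_right, Nat.mod_eq_of_lt (by omega)]
  rw [h1, h2]
  omega

/-- A family of vertices with the adjacencies of a cycle gives an induced cycle. -/
theorem nonempty_cycleGraph_embedding {n : ℕ} (x : Fin n → V)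
    (hne : ∀ i j, i < j → x i ≠ x j)
    (hadj : ∀ i j, i < j → (G.Adj (x i) (x j) ↔
      i.val + 1 = j.val ∨ (i.val = 0 ∧ j.val + 1 = n))) :
    Nonempty (SimpleGraph.cycleGraph n ↪g G) := by
  refine ⟨⟨⟨x, fun i j h ↦ ?_⟩, fun {i j} ↦ ?_⟩⟩
  · rcases lt_trichotomy i j with hij | hij | hij
    · exact absurd h (hne i j hij)
    · exact hij
    · exact absurd h.symm (hne j i hij)
  · change G.Adj (x i) (x j) ↔ _
    rcases lt_trichotomy i j with hij | rfl | hij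
    · rw [hadj i j hij, cycleGraph_adj_iff_of_lt hij]
    · simp
    · rw [G.adj_comm, hadj j i hij, SimpleGraph.adj_comm, cycleGraph_adj_iff_of_lt hij]

theorem getVert_ne_of_length_eq_dist {H : SimpleGraph V} {a b : V} (p : H.Walk a b)
    (hp : p.length = H.dist a b) {i j : ℕ} (hij : i < j) (hj : j ≤ p.length) :
    p.getVert i ≠ p.getVert j := by
  intro h
  have := H.dist_le ((p.take i).append ((p.drop j).copy h.symm rfl))
  rw [SimpleGraph.Walk.length_append, SimpleGraph.Walk.length_copy,
    SimpleGraph.Walk.take_length, SimpleGraph.Walk.drop_length] at this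
  omega

theorem adj_getVert_iff_of_length_eq_dist {H : SimpleGraph V} {a b : V} (p : H.Walk a b)
    (hp : p.length = H.dist a b) {i j : ℕ} (hij : i < j) (hj : j ≤ p.length) :
    H.Adj (p.getVert i) (p.getVert j) ↔ i + 1 = j := by
  refine ⟨fun h ↦ ?_, ?_⟩
  · have := H.dist_le ((p.take i).append (.cons h (p.drop j)))
    rw [SimpleGraph.Walk.length_append, SimpleGraph.Walk.length_cons,
      SimpleGraph.Walk.take_length, SimpleGraph.Walk.drop_length] at this
    omega
  · rintro rfl
    exact p.adj_getVert_succ (by omega)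

/-- Two neighbors of `v` that are connected through non-neighbors of `v` are adjacent. -/
theorem IsChordal.adj_of_reachable (hG : IsChordal G) {H : SimpleGraph V} {T : Set V}
    (hH : ∀ x y, H.Adj x y ↔ G.Adj x y ∧ x ∈ T ∧ y ∈ T) {v a b : V} (hab : a ≠ b)
    (hva : G.Adj v a) (hvb : G.Adj v b) (hvT : v ∉ T)
    (hT : ∀ x ∈ T, G.Adj v x → x = a ∨ x = b) (hr : H.Reachable a b) : G.Adj a b := by
  by_contra hnab
  obtain ⟨p, hp⟩ := hr.exists_walk_length_eq_dist
  have hl0 : p.length ≠ 0 := fun h ↦ hab (p.eq_of_length_eq_zero h)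
  have hl1 : p.length ≠ 1 := fun h ↦ hnab ((hH a b).1 (p.adj_of_length_eq_one h)).1
  have hmem : ∀ i ≤ p.length, p.getVert i ∈ T := by
    intro i hi
    rcases i with _ | i
    · exact ((hH _ _).1 (p.adj_getVert_succ (i := 0) (by omega))).2.1
    · exact ((hH _ _).1 (p.adj_getVert_succ (i := i) (by omega))).2.2
  have hvp : ∀ i ≤ p.length, (G.Adj v (p.getVert i) ↔ i = 0 ∨ i = p.length) := by
    intro i hi
    refine ⟨fun h ↦ ?_, ?_⟩
    · by_contra! hc
      rcases hT _ (hmem i hi) h with h | h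
      · exact getVert_ne_of_length_eq_dist p hp (i := 0) (by omega) hi (by simp [h])
      · exact getVert_ne_of_length_eq_dist p hp (lt_of_le_of_ne hi hc.2) le_rfl (by simp [h])
    · rintro (rfl | rfl)
      · simpa
      · simpa
  refine (not_nonempty_iff.2 (hG (p.length + 2) (by omega))) ?_
  refine nonempty_cycleGraph_embedding
    (fun i ↦ if i.val ≤ p.length then p.getVert i.val else v) ?_ ?_
  · rintro ⟨i, hi⟩ ⟨j, hj⟩ hij
    simp only [Fin.mk_lt_mk] at hij
    simp only [show i ≤ p.length by omega, if_true]
    split_ifs with hjl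
    · exact getVert_ne_of_length_eq_dist p hp hij hjl
    · intro h
      exact hvT (h ▸ hmem i (by omega))
  · rintro ⟨i, hi⟩ ⟨j, hj⟩ hij
    simp only [Fin.mk_lt_mk] at hij
    simp only [show i ≤ p.length by omega, if_true]
    split_ifs with hjl
    · have := adj_getVert_iff_of_length_eq_dist p hp hij hjl
      rw [hH] at this
      simp only [hmem i (by omega), hmem j hjl, and_true] at this
      rw [this]
      omega
    · rw [G.adj_comm, hvp i (by omega)]
      omega

/-- Dirac's lemma: outside the closed neighborhood of a vertex that does not dominate `W` there is
a simplicial vertex. -/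
theorem IsChordal.exists_simplicial_of_not_adj (hG : IsChordal G) (W : Finset V) :
    ∀ v ∈ W, (∃ c ∈ W, c ≠ v ∧ ¬ G.Adj v c) →
      ∃ s ∈ W, s ≠ v ∧ ¬ G.Adj v s ∧ G.IsClique {u | u ∈ W ∧ (u = s ∨ G.Adj s u)} := by
  classical
  induction W using Finset.strongInduction with
  | H W ih =>
    rintro v hv ⟨c, hcW, hcv, hvc⟩
    let H (T : Set V) : SimpleGraph V :=
      { Adj := fun x y ↦ G.Adj x y ∧ x ∈ T ∧ y ∈ T
        symm := ⟨fun x y h ↦ ⟨h.1.symm, h.2.2, h.2.1⟩⟩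
        loopless := ⟨fun x h ↦ G.loopless.irrefl x h.1⟩ }
    have hmono : ∀ T T', T ⊆ T' → H T ≤ H T' := fun T T' hTT x y h ↦ ⟨h.1, hTT h.2.1, hTT h.2.2⟩
    let U : Set V := {x | x ∈ W ∧ x ≠ v ∧ ¬ G.Adj v x}
    let C : Set V := {x | x ∈ U ∧ (H U).Reachable c x}
    let S : Set V := {u | u ∈ W ∧ u ∉ C ∧ ∃ x ∈ C, G.Adj u x}
    have hCstep : ∀ x ∈ C, ∀ y ∈ U, G.Adj x y → y ∈ C := fun x hx y hy hxy ↦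
      ⟨hy, hx.2.trans (SimpleGraph.Adj.reachable ⟨hxy, hx.1, hy⟩)⟩
    have hcC : c ∈ C := ⟨⟨hcW, hcv, hvc⟩, .refl _⟩
    have hSv : ∀ u ∈ S, G.Adj v u := by
      rintro u ⟨huW, huC, x, hx, hux⟩
      by_contra hn
      refine huC (hCstep x hx u ⟨huW, ?_, hn⟩ hux.symm)
      rintro rfl
      exact hx.1.2.2 hux
    have hSclique : G.IsClique S := by
      rintro a ha b hb hab
      obtain ⟨-, -, x, hx, hax⟩ := id ha
      obtain ⟨-, -, y, hy, hby⟩ := id hb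
      refine hG.adj_of_reachable (H := H (U ∪ {a, b})) (fun _ _ ↦ Iff.rfl) hab (hSv a ha)
        (hSv b hb) ?_ ?_ ?_
      · rintro (h | rfl | rfl)
        · exact h.2.1 rfl
        · exact G.loopless.irrefl _ (hSv _ ha)
        · exact G.loopless.irrefl _ (hSv _ hb)
      · rintro z (h | h | h) hz
        · exact absurd hz h.2.2
        · exact .inl h
        · exact .inr h
      · have h1 : (H (U ∪ {a, b})).Reachable a x :=
          SimpleGraph.Adj.reachable ⟨hax, by simp, .inl hx.1⟩
        have h2 : (H (U ∪ {a, b})).Reachable y b :=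
          SimpleGraph.Adj.reachable ⟨hby.symm, .inl hy.1, by simp⟩
        have h3 : (H U).Reachable x y := hx.2.symm.trans hy.2
        exact (h1.trans (h3.mono (hmono _ _ Set.subset_union_left))).trans h2
    let W' := W.filter fun x ↦ x ∈ C ∨ x ∈ S
    have hW' : W' ⊂ W := by
      refine Finset.filter_ssubset.2 ⟨v, hv, ?_⟩
      rintro (h | h)
      · exact h.1.2.1 rfl
      · exact G.loopless.irrefl _ (hSv _ h)
    have hnbr : ∀ s ∈ C, ∀ u ∈ W, (u = s ∨ G.Adj s u) → u ∈ W' := by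
      rintro s hs u hu (rfl | hsu)
      · exact Finset.mem_filter.2 ⟨hu, .inl hs⟩
      · by_cases huC : u ∈ C
        · exact Finset.mem_filter.2 ⟨hu, .inl huC⟩
        · exact Finset.mem_filter.2 ⟨hu, .inr ⟨hu, huC, s, hs, hsu.symm⟩⟩
    suffices ∃ s ∈ C, G.IsClique {u | u ∈ W' ∧ (u = s ∨ G.Adj s u)} by
      obtain ⟨s, hs, hcl⟩ := this
      refine ⟨s, hs.1.1, hs.1.2.1, hs.1.2.2, hcl.subset ?_⟩
      rintro u ⟨hu, hus⟩
      exact ⟨hnbr s hs u hu hus, hus⟩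
    by_cases hS : ∃ z ∈ S, ∃ y ∈ W', y ≠ z ∧ ¬ G.Adj z y
    · obtain ⟨z, hz, hy⟩ := hS
      obtain ⟨s, hsW, hsz, hzs, hcl⟩ :=
        ih W' hW' z (Finset.mem_filter.2 ⟨hz.1, .inr hz⟩) hy
      refine ⟨s, ?_, hcl⟩
      rcases (Finset.mem_filter.1 hsW).2 with h | h
      · exact h
      · exact absurd (hSclique hz h hsz.symm) hzs
    · by_cases hC : ∃ z ∈ C, ∃ y ∈ W', y ≠ z ∧ ¬ G.Adj z y
      · obtain ⟨z, hz, hy⟩ := hC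
        have hzW' : z ∈ W' := Finset.mem_filter.2 ⟨hz.1.1, .inl hz⟩
        obtain ⟨s, hsW, hsz, hzs, hcl⟩ := ih W' hW' z hzW' hy
        refine ⟨s, ?_, hcl⟩
        rcases (Finset.mem_filter.1 hsW).2 with h | h
        · exact h
        · exact (hS ⟨s, h, z, hzW', hsz.symm, fun h ↦ hzs h.symm⟩).elim
      · refine ⟨c, hcC, ?_⟩
        rintro x ⟨hx, -⟩ y ⟨hy, -⟩ hxy
        by_contra hn
        rcases (Finset.mem_filter.1 hx).2 with h | h
        · exact hC ⟨x, h, y, hy, hxy.symm, hn⟩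
        · exact hS ⟨x, h, y, hy, hxy.symm, hn⟩

theorem IsChordal.exists_simplicial (hG : IsChordal G) {W : Finset V} (hW : W.Nonempty) :
    ∃ s ∈ W, G.IsClique {u | u ∈ W ∧ (u = s ∨ G.Adj s u)} := by
  by_cases h : ∃ v ∈ W, ∃ c ∈ W, c ≠ v ∧ ¬ G.Adj v c
  · obtain ⟨v, hv, hc⟩ := h
    obtain ⟨s, hs, -, -, hcl⟩ := hG.exists_simplicial_of_not_adj W v hv hc
    exact ⟨s, hs, hcl⟩
  · obtain ⟨s, hs⟩ := hW
    refine ⟨s, hs, fun x hx y hy hxy ↦ ?_⟩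
    by_contra hn
    exact h ⟨x, hx.1, y, hy.1, hxy.symm, hn⟩

end Dirac

section Numeric

/-- `q (p ^ m - 1)` is the geometric sum `1 + p + ⋯ + p ^ (m - 1)` for `p = 41/25`, `q = 25/16`. -/
theorem numeric_dominated (a f b : ℕ) :
    (25/16 : ℝ) ^ (f + b) + 25/16 * ((41/25) ^ (a + f) - 1) ≤
      25/16 * (1.8940 ^ f * (41/25) ^ a * (25/16) ^ b) := by
  have hP : (1 : ℝ) ≤ (41/25) ^ a := one_le_pow₀ (by norm_num)
  have hQ : (1 : ℝ) ≤ (25/16) ^ b := one_le_pow₀ (by norm_num)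
  have h1 : (25/16 : ℝ) ^ f ≤ 1.8940 ^ f := pow_le_pow_left₀ (by norm_num) (by norm_num) _
  have h2 : (41/25 : ℝ) ^ f ≤ 1.8940 ^ f := pow_le_pow_left₀ (by norm_num) (by norm_num) _
  have h3 : (25/16 : ℝ) ^ f + 25/16 * (41/25) ^ f - 25/16 ≤ 25/16 * 1.8940 ^ f := by
    rcases f with _ | _ | f
    · norm_num
    · norm_num
    · induction f with
      | zero => norm_num
      | succ k ih =>
        have := ih (pow_le_pow_left₀ (by norm_num) (by norm_num) _)
          (pow_le_pow_left₀ (by norm_num) (by norm_num) _)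
        have h4 : (1 : ℝ) ≤ 1.8940 ^ k := one_le_pow₀ (by norm_num)
        have h5 : (0 : ℝ) ≤ (25/16) ^ k := by positivity
        simp only [pow_succ] at *
        linarith
  have hX : (0 : ℝ) ≤ 1.8940 ^ f := by positivity
  rw [pow_add, pow_add]
  generalize (25/16 : ℝ) ^ f = Y at *
  generalize (41/25 : ℝ) ^ f = Z at *
  generalize (1.8940 : ℝ) ^ f = X at *
  generalize (41/25 : ℝ) ^ a = P at *
  generalize (25/16 : ℝ) ^ b = Q at *
  nlinarith [mul_nonneg (sub_nonneg.2 hP) (sub_nonneg.2 h2),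
    mul_nonneg (sub_nonneg.2 hQ) (sub_nonneg.2 h1),
    mul_nonneg (sub_nonneg.2 hQ) hX, mul_nonneg (mul_nonneg (sub_nonneg.2 hQ) (sub_nonneg.2 hP)) hX]

theorem numeric_free (a f b : ℕ) (h : 1 ≤ a + f + b) :
    (25/16 : ℝ) ^ (f + b) + 25/16 * ((41/25) ^ (a + f) - 1) + 1 ≤
      1.8940 * (1.8940 ^ f * (41/25) ^ a * (25/16) ^ b) := by
  have hP : (1 : ℝ) ≤ (41/25) ^ a := one_le_pow₀ (by norm_num)
  have hQ : (1 : ℝ) ≤ (25/16) ^ b := one_le_pow₀ (by norm_num)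
  rcases f with _ | f
  · rcases a with _ | a
    · have : (25/16 : ℝ) ≤ (25/16) ^ b := le_self_pow₀ (by norm_num) (by omega)
      simp
      linarith
    · have : (41/25 : ℝ) ≤ (41/25) ^ (a + 1) := le_self_pow₀ (by norm_num) (by omega)
      simp only [zero_add, add_zero, pow_zero, one_mul]
      nlinarith [mul_nonneg (sub_nonneg.2 hP) (sub_nonneg.2 hQ)]
  · have h1 : (25/16 : ℝ) ^ (f + 1) ≤ 1.8940 ^ (f + 1) :=
      pow_le_pow_left₀ (by norm_num) (by norm_num) _
    have h2 : (41/25 : ℝ) ^ (f + 1) ≤ 1.8940 ^ (f + 1) :=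
      pow_le_pow_left₀ (by norm_num) (by norm_num) _
    have hX : (0 : ℝ) ≤ 1.8940 ^ (f + 1) := by positivity
    have h3 : (25/16 : ℝ) ^ (f + 1) + 25/16 * (41/25) ^ (f + 1) - 25/16 + 1 ≤
        1.8940 * 1.8940 ^ (f + 1) := by
      clear h hX h1 h2
      induction f with
      | zero => norm_num
      | succ k ih =>
        have h4 : (1 : ℝ) ≤ 1.8940 ^ k := one_le_pow₀ (by norm_num)
        have h5 : (0 : ℝ) ≤ (25/16) ^ k := by positivity
        simp only [pow_succ] at *
        linarith
    rw [pow_add _ (f + 1), pow_add _ a]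
    generalize (25/16 : ℝ) ^ (f + 1) = Y at *
    generalize (41/25 : ℝ) ^ (f + 1) = Z at *
    generalize (1.8940 : ℝ) ^ (f + 1) = X at *
    generalize (41/25 : ℝ) ^ a = P at *
    generalize (25/16 : ℝ) ^ b = Q at *
    nlinarith [mul_nonneg (sub_nonneg.2 hP) (sub_nonneg.2 h2),
      mul_nonneg (sub_nonneg.2 hQ) (sub_nonneg.2 h1), mul_nonneg (sub_nonneg.2 hP) hX,
      mul_nonneg (sub_nonneg.2 hQ) hX,
      mul_nonneg (mul_nonneg (sub_nonneg.2 hQ) (sub_nonneg.2 hP)) hX]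

theorem numeric_active (a f b : ℕ) (h : 1 ≤ a + f + b) :
    (1.8940 : ℝ) ^ f * (41/25) ^ a * (25/16) ^ b + 1 ≤
      41/25 * (1.8940 ^ f * (41/25) ^ a * (25/16) ^ b) := by
  have h1 : (25/16 : ℝ) ^ f ≤ 1.8940 ^ f := pow_le_pow_left₀ (by norm_num) (by norm_num) _
  have h2 : (25/16 : ℝ) ^ a ≤ (41/25) ^ a := pow_le_pow_left₀ (by norm_num) (by norm_num) _
  have h3 : (25/16 : ℝ) ≤ (25/16) ^ (f + a + b) := le_self_pow₀ (by norm_num) (by omega)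
  have h4 : (25/16 : ℝ) ^ (f + a + b) ≤ 1.8940 ^ f * (41/25) ^ a * (25/16) ^ b := by
    rw [pow_add, pow_add]
    gcongr
  linarith

end Numeric

section Roman
variable {V : Type*} [Fintype V] [DecidableEq V]

open Classical in
/-- The sets `D ⊆ A` each of whose elements has a private neighbor in `B \ D`. -/
noncomputable def privateSets (G : SimpleGraph V) (A B : Finset V) : Finset (Finset V) :=
  A.powerset.filter fun D ↦ ∀ v ∈ D, ∃ w ∈ B, w ∉ D ∧ G.Adj v w ∧ ∀ u ∈ D, G.Adj u w → u = v

theorem mem_privateSets {G : SimpleGraph V} {A B D : Finset V} :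
    D ∈ privateSets G A B ↔ D ⊆ A ∧
      ∀ v ∈ D, ∃ w ∈ B, w ∉ D ∧ G.Adj v w ∧ ∀ u ∈ D, G.Adj u w → u = v := by
  simp [privateSets]

theorem numMinRDF_le_card_privateSets (G : SimpleGraph V) :
    numMinRDF G ≤ (privateSets G Finset.univ Finset.univ).card := by
  classical
  rw [numMinRDF, ← Set.ncard_coe_finset]
  refine Set.ncard_le_ncard_of_injOn (fun f ↦ Finset.univ.filter fun v ↦ f v = 2) ?_ ?_
    (Finset.finite_toSet _)
  · rintro f ⟨hf, hmin⟩
    simp only [SetLike.mem_coe, mem_privateSets, Finset.subset_univ, true_and, Finset.mem_filter,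
      Finset.mem_univ]
    intro v hv
    have hg : ¬ IsRDF G (Function.update f v 1) := fun h ↦ by
      have := congrFun (hmin _ h (update_le_self_iff.2 (by rw [hv]; decide))) v
      rw [Function.update_self, hv] at this
      exact absurd this (by decide)
    unfold IsRDF at hg
    push Not at hg
    obtain ⟨w, hw0, hw⟩ := hg
    have hwv : w ≠ v := by
      rintro rfl
      simp at hw0
    rw [Function.update_of_ne hwv] at hw0
    have key : ∀ u, f u = 2 → G.Adj u w → u = v := fun u hu huw ↦ by
      by_contra huv
      exact hw u huw.symm (by rw [Function.update_of_ne huv, hu])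
    obtain ⟨u, hwu, hu⟩ := hf w hw0
    refine ⟨w, by rw [hw0]; decide, ?_, key⟩
    rw [← key u hu hwu.symm]
    exact hwu.symm
  · have key : ∀ f, IsMinimalRDF G f → ∀ v, f v ≠ 2 → (f v = 0 ↔ ∃ u, G.Adj v u ∧ f u = 2) := by
      rintro f ⟨hf, hmin⟩ v hv
      refine ⟨hf v, fun ⟨u, hvu, hu⟩ ↦ ?_⟩
      have := congrFun (hmin (Function.update f v 0) ?_
        (update_le_self_iff.2 (Fin.zero_le _))) v
      · rw [← this, Function.update_self]
      · have aux : ∀ y, f y = 2 → Function.update f v 0 y = 2 := fun y hy ↦ by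
          rwa [Function.update_of_ne]
          rintro rfl
          exact hv hy
        intro w hw
        by_cases hwv : w = v
        · exact ⟨u, hwv ▸ hvu, aux u hu⟩
        · rw [Function.update_of_ne hwv] at hw
          obtain ⟨y, hwy, hy⟩ := hf w hw
          exact ⟨y, hwy, aux y hy⟩
    intro f hf g hg hfg
    have h2 : ∀ v, f v = 2 ↔ g v = 2 := fun v ↦ by
      simpa using Finset.ext_iff.1 hfg v
    funext v
    by_cases hv : f v = 2
    · rw [hv, (h2 v).1 hv]
    · have h0 : f v = 0 ↔ g v = 0 := by
        rw [key f hf v hv, key g hg v (mt (h2 v).2 hv)]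
        simp only [h2]
      have := h2 v
      generalize f v = i at *
      generalize g v = j at *
      revert i j
      decide

end Roman

open Finset

section Count
variable {V : Type*} [DecidableEq V] {G : SimpleGraph V} {A B : Finset V}

section Branching
variable [Fintype V]

theorem card_privateSets_empty_left (G : SimpleGraph V) (B : Finset V) :
    #(privateSets G ∅ B) ≤ 1 := by
  rw [← Finset.card_singleton (∅ : Finset V)]
  exact card_le_card fun D hD ↦
    mem_singleton.2 (subset_empty.1 (mem_privateSets.1 hD).1)

theorem privateSets_mono_right {B' : Finset V} (h : B ⊆ B') :
    privateSets G A B ⊆ privateSets G A B' := by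
  intro D hD
  rw [mem_privateSets] at *
  refine ⟨hD.1, fun v hv ↦ ?_⟩
  obtain ⟨w, hw, h'⟩ := hD.2 v hv
  exact ⟨w, h hw, h'⟩

theorem mem_privateSets_erase {D : Finset V} {v : V} (hD : D ∈ privateSets G A B) (hv : v ∉ D) :
    D ∈ privateSets G (A.erase v) B := by
  rw [mem_privateSets] at *
  exact ⟨subset_erase.2 ⟨hD.1, hv⟩, hD.2⟩

/-- If `v ∈ D`, its neighbors are not private neighbors of other vertices. -/
theorem erase_mem_privateSets {D K : Finset V} {v : V} (hD : D ∈ privateSets G A B) (hv : v ∈ D)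
    (hK : ∀ w ∈ K, w = v ∨ G.Adj v w) :
    D.erase v ∈ privateSets G (A.erase v) (B \ K) := by
  rw [mem_privateSets] at *
  refine ⟨erase_subset_erase _ hD.1, fun u hu ↦ ?_⟩
  obtain ⟨huv, hu⟩ := mem_erase.1 hu
  obtain ⟨w, hw, hwD, huw, hp⟩ := hD.2 u hu
  refine ⟨w, mem_sdiff.2 ⟨hw, fun hwK ↦ ?_⟩, fun h ↦ hwD (mem_of_mem_erase h), huw,
    fun y hy ↦ hp y (mem_of_mem_erase hy)⟩
  rcases hK w hwK with rfl | h
  · exact hwD hv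
  · exact huv (hp v hv h).symm

/-- Splitting according to whether `v ∈ D`. -/
theorem card_privateSets_le_add {A' B' : Finset V} (v : V)
    (h : ∀ D ∈ privateSets G A B, v ∈ D → D.erase v ∈ privateSets G A' B') :
    #(privateSets G A B) ≤ #(privateSets G (A.erase v) B) + #(privateSets G A' B') := by
  rw [add_comm, ← card_filter_add_card_filter_not (s := privateSets G A B) (fun D ↦ v ∈ D)]
  refine add_le_add (card_le_card_of_injOn (fun D ↦ D.erase v) ?_ ?_) (card_le_card ?_)
  · intro D hD
    have := mem_filter.1 hD
    exact h D this.1 this.2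
  · intro D hD D' hD' hDD
    rw [← insert_erase (mem_filter.1 hD).2, ← insert_erase (mem_filter.1 hD').2]
    exact congrArg (insert v) hDD
  · intro D hD
    have := mem_filter.1 hD
    exact mem_privateSets_erase this.1 this.2

theorem card_privateSets_le_add_of_clique {K : Finset V} {v : V}
    (hK : ∀ w ∈ K, w = v ∨ G.Adj v w) :
    #(privateSets G A B) ≤
      #(privateSets G (A.erase v) B) + #(privateSets G (A.erase v) (B \ K)) :=
  card_privateSets_le_add v fun _ hD hv ↦ erase_mem_privateSets hD hv hK

/-- A simplicial vertex `s ∈ D` has a private neighbor in the clique `K` of its neighbors, so no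
other vertex of `K` lies in `D`. -/
theorem card_privateSets_le_add_of_simplicial {K : Finset V} {s : V} (hs : s ∈ K)
    (hK : G.IsClique K) (hBK : ∀ w ∈ B, G.Adj s w → w ∈ K) :
    #(privateSets G A B) ≤ #(privateSets G (A.erase s) B) + #(privateSets G (A \ K) (B \ K)) := by
  refine card_privateSets_le_add s fun D hD hsD ↦ ?_
  have h1 := erase_mem_privateSets hD hsD (K := K)
    fun w hw ↦ or_iff_not_imp_left.2 fun hne ↦ hK hs hw (Ne.symm hne)
  rw [mem_privateSets] at *
  refine ⟨fun u hu ↦ mem_sdiff.2 ⟨mem_of_mem_erase (h1.1 hu), fun huK ↦ ?_⟩, h1.2⟩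
  obtain ⟨w, hw, hwD, hsw, hp⟩ := hD.2 s hsD
  obtain ⟨hus, huD⟩ := mem_erase.1 hu
  refine hus (hp u huD (hK huK (hBK w hw hsw) ?_))
  rintro rfl
  exact hwD huD

theorem privateSets_erase_left_of_isolated {s : V} (h : ∀ w ∈ B, ¬ G.Adj s w) :
    privateSets G A B ⊆ privateSets G (A.erase s) B := by
  intro D hD
  refine mem_privateSets_erase hD fun hs ↦ ?_
  obtain ⟨w, hw, -, hsw, -⟩ := (mem_privateSets.1 hD).2 s hs
  exact h w hw hsw

theorem privateSets_erase_right_of_isolated {s : V} (h : ∀ u ∈ A, ¬ G.Adj u s) :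
    privateSets G A B ⊆ privateSets G A (B.erase s) := by
  intro D hD
  rw [mem_privateSets] at *
  refine ⟨hD.1, fun v hv ↦ ?_⟩
  obtain ⟨w, hw, hwD, hvw, hp⟩ := hD.2 v hv
  refine ⟨w, mem_erase.2 ⟨?_, hw⟩, hwD, hvw, hp⟩
  rintro rfl
  exact h v (hD.1 hv) hvw

end Branching

/-- The weight of an instance: vertices of `A ∩ B`, `A \ B` and `B \ A` count with the factors
`1.8940`, `41/25` and `25/16`. -/
noncomputable def weight (A B : Finset V) : ℝ :=
  1.8940 ^ #(A ∩ B) * (41/25) ^ #(A \ B) * (25/16) ^ #(B \ A)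

theorem weight_pos (A B : Finset V) : 0 < weight A B := by
  unfold weight
  positivity

theorem one_le_weight (A B : Finset V) : 1 ≤ weight A B :=
  one_le_mul_of_one_le_of_one_le (one_le_mul_of_one_le_of_one_le (one_le_pow₀ (by norm_num))
    (one_le_pow₀ (by norm_num))) (one_le_pow₀ (by norm_num))

theorem weight_eq_mul (A B K : Finset V) :
    weight A B = weight (A \ K) (B \ K) * weight (A ∩ K) (B ∩ K) := by
  have h1 : (A ∩ B) \ K = (A \ K) ∩ (B \ K) := by grind
  have h2 : (A ∩ B) ∩ K = (A ∩ K) ∩ (B ∩ K) := by grind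
  have h3 : (A \ B) \ K = (A \ K) \ (B \ K) := by grind
  have h4 : (A \ B) ∩ K = (A ∩ K) \ (B ∩ K) := by grind
  have h5 : (B \ A) \ K = (B \ K) \ (A \ K) := by grind
  have h6 : (B \ A) ∩ K = (B ∩ K) \ (A ∩ K) := by grind
  have h (X : Finset V) : #X = #(X \ K) + #(X ∩ K) := by
    rw [add_comm, card_inter_add_card_sdiff]
  unfold weight
  rw [h (A ∩ B), h (A \ B), h (B \ A), h1, h2, h3, h4, h5, h6]
  ring

theorem weight_empty_right (A : Finset V) : weight A ∅ = (41/25) ^ #A := by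
  simp [weight]

theorem weight_empty_left (B : Finset V) : weight ∅ B = (25/16) ^ #B := by
  simp [weight]

variable [Fintype V]

/-- The recursion at a simplicial vertex `s` outside `A`: with `m` vertices of `A` in its clique
`K`, either no vertex of `K` is chosen or we branch on the first chosen one. -/
theorem card_privateSets_le_of_dominated {K : Finset V} {s : V} (hs : s ∈ K)
    (hK : G.IsClique K) (m : ℕ) (hm : #(A ∩ K) = m) (hAK : ∀ u ∈ A, G.Adj u s → u ∈ K)
    (ih : ∀ A' ⊆ A, ∀ B' ⊆ B, s ∉ B' → (#(privateSets G A' B') : ℝ) ≤ weight A' B') :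
    (#(privateSets G A B) : ℝ) ≤ weight (A \ K) (B \ K) *
      ((25/16) ^ #((B ∩ K).erase s) + 25/16 * ((41/25) ^ m - 1)) := by
  induction m generalizing A with
  | zero =>
    have hdisj : A ∩ K = ∅ := card_eq_zero.1 hm
    have h1 : privateSets G A B ⊆ privateSets G A (B.erase s) := by
      refine privateSets_erase_right_of_isolated fun u hu hus ↦ ?_
      have : u ∈ A ∩ K := mem_inter.2 ⟨hu, hAK u hu hus⟩
      simp [hdisj] at this
    have h2 := ih A subset_rfl (B.erase s) (erase_subset _ _) (notMem_erase _ _)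
    rw [weight_eq_mul A (B.erase s) K, hdisj, weight_empty_left,
      show B.erase s \ K = B \ K by grind, show B.erase s ∩ K = (B ∩ K).erase s by grind] at h2
    refine (Nat.cast_le.2 (card_le_card h1)).trans (h2.trans_eq ?_)
    simp
  | succ m ihm =>
    obtain ⟨v, hv⟩ : (A ∩ K).Nonempty := card_pos.1 (by omega)
    obtain ⟨hvA, hvK⟩ := mem_inter.1 hv
    have hcard : #(A.erase v ∩ K) = m := by
      rw [show A.erase v ∩ K = (A ∩ K).erase v by grind, card_erase_of_mem hv, hm]
      rfl
    have h1 := card_privateSets_le_add_of_clique (G := G) (A := A) (B := B) (K := K) (v := v)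
      fun w hw ↦ or_iff_not_imp_left.2 fun hne ↦ hK hvK hw (Ne.symm hne)
    have h2 := ihm hcard (fun u hu ↦ hAK u (mem_of_mem_erase hu))
      fun A' hA' ↦ ih A' (hA'.trans (erase_subset _ _))
    have h3 := ih (A.erase v) (erase_subset _ _) (B \ K) sdiff_subset fun h ↦
      (mem_sdiff.1 h).2 hs
    rw [weight_eq_mul (A.erase v) (B \ K) K, show (B \ K) ∩ K = ∅ by grind, weight_empty_right,
      hcard, Finset.sdiff_idem] at h3
    rw [show A.erase v \ K = A \ K by grind] at h2 h3
    refine (Nat.cast_le.2 h1).trans ?_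
    rw [Nat.cast_add]
    refine (add_le_add h2 h3).trans_eq ?_
    ring

theorem card_privateSets_le_weight (hG : IsChordal G) (A B : Finset V) :
    (#(privateSets G A B) : ℝ) ≤ weight A B := by
  induction hn : #A + #B using Nat.strong_induction_on generalizing A B with
  | _ n ih =>
  subst hn
  rcases (A ∪ B).eq_empty_or_nonempty with hAB | hAB
  · obtain ⟨rfl, rfl⟩ := union_eq_empty.1 hAB
    exact (Nat.cast_le.2 (card_privateSets_empty_left G ∅)).trans (by simpa using one_le_weight ∅ ∅)
  obtain ⟨s, hs, hcl⟩ := hG.exists_simplicial hAB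
  classical
  let K := (A ∪ B).filter fun u ↦ u = s ∨ G.Adj s u
  have hsK : s ∈ K := mem_filter.2 ⟨hs, .inl rfl⟩
  have hKcl : G.IsClique K := hcl.subset fun u hu ↦ mem_filter.1 hu
  have hKsub : K ⊆ A ∪ B := filter_subset _ _
  have hAK : ∀ u ∈ A, G.Adj u s → u ∈ K := fun u hu h ↦
    mem_filter.2 ⟨mem_union_left _ hu, .inr h.symm⟩
  have hBK : ∀ u ∈ B, G.Adj s u → u ∈ K := fun u hu h ↦
    mem_filter.2 ⟨mem_union_right _ hu, .inr h⟩
  clear_value K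
  have ih' : ∀ A' ⊆ A, ∀ B' ⊆ B, #A' + #B' < #A + #B →
      (#(privateSets G A' B') : ℝ) ≤ weight A' B' := fun A' _ B' _ h ↦ ih _ h A' B' rfl
  have hsd : (#(privateSets G (A \ K) (B \ K)) : ℝ) ≤ weight (A \ K) (B \ K) := by
    refine ih' _ sdiff_subset _ sdiff_subset ?_
    rcases mem_union.1 hs with h | h
    · have : #(A \ K) < #A := card_lt_card (ssubset_iff_of_subset sdiff_subset |>.2
        ⟨s, h, fun h' ↦ (mem_sdiff.1 h').2 hsK⟩)
      have := card_le_card (sdiff_subset (s := B) (t := K))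
      omega
    · have : #(B \ K) < #B := card_lt_card (ssubset_iff_of_subset sdiff_subset |>.2
        ⟨s, h, fun h' ↦ (mem_sdiff.1 h').2 hsK⟩)
      have := card_le_card (sdiff_subset (s := A) (t := K))
      omega
  have hpos := weight_pos (A \ K) (B \ K)
  -- the numbers of neighbors of `s` of each kind
  let A₀ := (A ∩ K).erase s
  let B₀ := (B ∩ K).erase s
  have hA₀ : #A₀ = #(A₀ \ B₀) + #(A₀ ∩ B₀) := by rw [card_sdiff_add_card_inter]
  have hB₀ : #B₀ = #(A₀ ∩ B₀) + #(B₀ \ A₀) := by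
    rw [inter_comm, card_inter_add_card_sdiff]
  have hweight : weight (A ∩ K) (B ∩ K) = weight A₀ B₀ * weight (A ∩ {s}) (B ∩ {s}) := by
    rw [weight_eq_mul (A ∩ K) (B ∩ K) {s}, sdiff_singleton_eq_erase, sdiff_singleton_eq_erase,
      inter_assoc, inter_assoc, inter_eq_right.2 (singleton_subset_iff.2 hsK)]
  by_cases hiso : K ⊆ {s}
  · have hKs : K = {s} := subset_antisymm hiso (singleton_subset_iff.2 hsK)
    subst hKs
    have hnadj : ∀ u, u ∈ ({s} : Finset V) → ¬ G.Adj s u := fun u hu h ↦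
      G.loopless.irrefl s (mem_singleton.1 hu ▸ h)
    have h1 : privateSets G A B ⊆ privateSets G (A \ {s}) (B \ {s}) := by
      rw [sdiff_singleton_eq_erase, sdiff_singleton_eq_erase]
      refine (privateSets_erase_left_of_isolated fun w hw h ↦ hnadj w (hBK w hw h) h).trans
        (privateSets_erase_right_of_isolated fun u hu h ↦ ?_)
      exact hnadj u (hAK u (mem_of_mem_erase hu) h) h.symm
    rw [weight_eq_mul A B {s}]
    exact (Nat.cast_le.2 (card_le_card h1)).trans (hsd.trans
      (le_mul_of_one_le_right hpos.le (one_le_weight _ _)))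
  have hcount : 1 ≤ #(A₀ \ B₀) + #(A₀ ∩ B₀) + #(B₀ \ A₀) := by
    obtain ⟨u, huK, hus⟩ := not_subset.1 hiso
    rw [mem_singleton] at hus
    have hu : u ∈ A₀ ∪ B₀ := by
      rcases mem_union.1 (hKsub huK) with h | h
      · exact mem_union_left _ (mem_erase.2 ⟨hus, mem_inter.2 ⟨h, huK⟩⟩)
      · exact mem_union_right _ (mem_erase.2 ⟨hus, mem_inter.2 ⟨h, huK⟩⟩)
    have := card_pos.2 ⟨u, hu⟩
    have := card_union_le A₀ B₀
    omega
  have herase : A.erase s \ K = A \ K := by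
    ext u
    simp only [mem_sdiff, mem_erase]
    exact ⟨fun h ↦ ⟨h.1.2, h.2⟩, fun h ↦ ⟨⟨fun hus ↦ h.2 (hus ▸ hsK), h.1⟩, h.2⟩⟩
  by_cases hsA : s ∈ A
  · have hsplit := card_privateSets_le_add_of_simplicial (A := A) hsK hKcl hBK
    have hsplit' : (#(privateSets G A B) : ℝ) ≤ #(privateSets G (A.erase s) B) +
        #(privateSets G (A \ K) (B \ K)) := by exact_mod_cast hsplit
    have hlt : #(A.erase s) < #A := card_erase_lt_of_mem hsA
    by_cases hsB : s ∈ B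
    · have h1 := card_privateSets_le_of_dominated (A := A.erase s) hsK hKcl #A₀
        (by rw [erase_inter]) (fun u hu ↦ hAK u (mem_of_mem_erase hu))
        fun A' hA' B' hB' _ ↦ ih' A' (hA'.trans (erase_subset _ _)) B' hB' (by
          have := card_le_card hA'
          have := card_le_card hB'
          omega)
      rw [herase, hA₀, hB₀] at h1
      have h2 := numeric_free #(A₀ \ B₀) #(A₀ ∩ B₀) #(B₀ \ A₀) hcount
      have h3 : weight (A ∩ {s}) (B ∩ {s}) = 1.8940 := by
        simp [weight, hsA, hsB]
      rw [weight_eq_mul A B K, hweight, h3, mul_comm _ (1.8940 : ℝ)]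
      change _ ≤ 1.8940 * weight A₀ B₀ at h2
      nlinarith [mul_le_mul_of_nonneg_left h2 hpos.le]
    · have h1 := ih' (A.erase s) (erase_subset _ _) B subset_rfl (by omega)
      rw [weight_eq_mul _ _ K, herase,
        erase_inter,
        ← erase_eq_of_notMem fun h : s ∈ B ∩ K ↦ hsB (mem_inter.1 h).1] at h1
      have h2 := numeric_active #(A₀ \ B₀) #(A₀ ∩ B₀) #(B₀ \ A₀) hcount
      have h3 : weight (A ∩ {s}) (B ∩ {s}) = 41/25 := by
        simp [weight, hsA, hsB]
      rw [weight_eq_mul A B K, hweight, h3, mul_comm _ (41/25 : ℝ)]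
      change weight A₀ B₀ + 1 ≤ 41/25 * weight A₀ B₀ at h2
      nlinarith [mul_le_mul_of_nonneg_left h2 hpos.le]
  · have hsB : s ∈ B := (mem_union.1 hs).resolve_left hsA
    have h1 := card_privateSets_le_of_dominated (A := A) hsK hKcl #A₀
        (congrArg card (erase_eq_of_notMem fun h ↦ hsA (mem_inter.1 h).1).symm) hAK fun A' hA' B' hB' hsB' ↦ ih' A' hA' B' hB' (by
          have := card_le_card hA'
          have := card_lt_card (ssubset_iff_of_subset hB' |>.2 ⟨s, hsB, hsB'⟩)
          omega)
    rw [hA₀, hB₀] at h1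
    have h2 := numeric_dominated #(A₀ \ B₀) #(A₀ ∩ B₀) #(B₀ \ A₀)
    have h3 : weight (A ∩ {s}) (B ∩ {s}) = 25/16 := by
      simp [weight, hsA, hsB]
    rw [weight_eq_mul A B K, hweight, h3, mul_comm _ (25/16 : ℝ)]
    change _ ≤ 25/16 * weight A₀ B₀ at h2
    exact h1.trans (mul_le_mul_of_nonneg_left h2 hpos.le)

end Count

/-- There is a constant `C > 0` such that every chordal graph of order `n` has at most
`C · 1.8940ⁿ` minimal Roman dominating functions. -/
theorem chordal_numMinRDF_le :
    ∃ C : ℝ, 0 < C ∧ ∀ (V : Type) [Fintype V] (G : SimpleGraph V),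
      IsChordal G → (numMinRDF G : ℝ) ≤ C * 1.8940 ^ (Fintype.card V) := by
  classical
  refine ⟨1, one_pos, fun V _ G hG ↦ ?_⟩
  refine (Nat.cast_le.2 (numMinRDF_le_card_privateSets G)).trans
    ((card_privateSets_le_weight hG _ _).trans_eq ?_)
  simp [weight]
end
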